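/- arXiv:2504.13158 — 14 statements merged into one kernel-verified Lean document; each statement's English description precedes it below -/
import Mathlib

section
/- Under the Smith–Scott model, for every θ ∈ [0,1], the expected gain from a one-unit pass-line bet under the optimal dice-set strategy satisfies 2·[ p_AA(7,θ) + p_AA(11,θ) + Σ_{x∈{4,5,9,10}} p_AA(x,θ)·p_AC(x,θ)/(p_AC(x,θ)+p_AC(7,θ)) + Σ_{x∈{6,8}} p_AA(x,θ)·p_AB(x,θ)/(p_AB(x,θ)+p_AB(7,θ)) ] − 1 = −(448 − 10064θ + 72θ² + 68θ³ − θ⁴)/(72(10−θ)(44+θ)). -/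
/-- The three on-axis face sets of the Smith–Scott model. -/
def ssA : Finset ℕ := {2, 3, 4, 5}
def ssB : Finset ℕ := {1, 3, 4, 6}
def ssC : Finset ℕ := {1, 2, 5, 6}

/-- Distribution of dice totals for fair dice. -/
noncomputable def pSS (x : ℕ) : ℝ := (6 - |(x : ℝ) - 7|) / 36

/-- Distribution of dice totals under perfect control with set `U`–`V`. -/
noncomputable def pUV (U V : Finset ℕ) (x : ℕ) : ℝ :=
  (((U ×ˢ V).filter (fun p => p.1 + p.2 = x)).card : ℝ) / 16

/-- Smith–Scott model distribution of dice totals with control parameter `θ`. -/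
noncomputable def pUVθ (U V : Finset ℕ) (x : ℕ) (θ : ℝ) : ℝ :=
  (1 - θ) * pSS x + θ * pUV U V x

theorem pUVθ_eq_of_card {U V : Finset ℕ} {x n : ℕ}
    (h : ((U ×ˢ V).filter (fun p => p.1 + p.2 = x)).card = n) (θ : ℝ) :
    pUVθ U V x θ = (1 - θ) * ((6 - |(x : ℝ) - 7|) / 36) + θ * (n / 16) := by
  rw [pUVθ, pSS, pUV, h]

/-- Under the Smith–Scott model, the expected gain from a one-unit pass-line bet
under the optimal dice-set strategy ($AA$ on come-out, $AC$ on points 4,5,9,10,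
$AB$ on points 6,8). -/
theorem smith_scott_expected_gain (θ : ℝ) (hθ : θ ∈ Set.Icc (0 : ℝ) 1) :
    2 * (pUVθ ssA ssA 7 θ + pUVθ ssA ssA 11 θ +
        (∑ x ∈ ({4, 5, 9, 10} : Finset ℕ), pUVθ ssA ssA x θ *
          (pUVθ ssA ssC x θ / (pUVθ ssA ssC x θ + pUVθ ssA ssC 7 θ))) +
        (∑ x ∈ ({6, 8} : Finset ℕ), pUVθ ssA ssA x θ *
          (pUVθ ssA ssB x θ / (pUVθ ssA ssB x θ + pUVθ ssA ssB 7 θ)))) - 1 =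
      -(448 - 10064 * θ + 72 * θ ^ 2 + 68 * θ ^ 3 - θ ^ 4) /
        (72 * (10 - θ) * (44 + θ)) := by
  obtain ⟨hθ0, hθ1⟩ := hθ
  have h10 : 10 - θ ≠ 0 := by linarith
  have h44 : 44 + θ ≠ 0 := by linarith
  have aa4 : pUVθ ssA ssA 4 θ = (1 - θ) * (3 / 36) + θ * (1 / 16) := by
    rw [pUVθ_eq_of_card (n := 1) (by decide)]; norm_num [abs_of_nonneg, abs_of_neg]
  have aa5 : pUVθ ssA ssA 5 θ = (1 - θ) * (4 / 36) + θ * (2 / 16) := by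
    rw [pUVθ_eq_of_card (n := 2) (by decide)]; norm_num [abs_of_nonneg, abs_of_neg]
  have aa6 : pUVθ ssA ssA 6 θ = (1 - θ) * (5 / 36) + θ * (3 / 16) := by
    rw [pUVθ_eq_of_card (n := 3) (by decide)]; norm_num [abs_of_nonneg, abs_of_neg]
  have aa7 : pUVθ ssA ssA 7 θ = (1 - θ) * (6 / 36) + θ * (4 / 16) := by
    rw [pUVθ_eq_of_card (n := 4) (by decide)]; norm_num [abs_of_nonneg, abs_of_neg]
  have aa8 : pUVθ ssA ssA 8 θ = (1 - θ) * (5 / 36) + θ * (3 / 16) := by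
    rw [pUVθ_eq_of_card (n := 3) (by decide)]; norm_num [abs_of_nonneg, abs_of_neg]
  have aa9 : pUVθ ssA ssA 9 θ = (1 - θ) * (4 / 36) + θ * (2 / 16) := by
    rw [pUVθ_eq_of_card (n := 2) (by decide)]; norm_num [abs_of_nonneg, abs_of_neg]
  have aa10 : pUVθ ssA ssA 10 θ = (1 - θ) * (3 / 36) + θ * (1 / 16) := by
    rw [pUVθ_eq_of_card (n := 1) (by decide)]; norm_num [abs_of_nonneg, abs_of_neg]
  have aa11 : pUVθ ssA ssA 11 θ = (1 - θ) * (2 / 36) + θ * (0 / 16) := by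
    rw [pUVθ_eq_of_card (n := 0) (by decide)]; norm_num [abs_of_nonneg, abs_of_neg]
  have ac4 : pUVθ ssA ssC 4 θ = (1 - θ) * (3 / 36) + θ * (2 / 16) := by
    rw [pUVθ_eq_of_card (n := 2) (by decide)]; norm_num [abs_of_nonneg, abs_of_neg]
  have ac5 : pUVθ ssA ssC 5 θ = (1 - θ) * (4 / 36) + θ * (2 / 16) := by
    rw [pUVθ_eq_of_card (n := 2) (by decide)]; norm_num [abs_of_nonneg, abs_of_neg]
  have ac7 : pUVθ ssA ssC 7 θ = (1 - θ) * (6 / 36) + θ * (2 / 16) := by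
    rw [pUVθ_eq_of_card (n := 2) (by decide)]; norm_num [abs_of_nonneg, abs_of_neg]
  have ac9 : pUVθ ssA ssC 9 θ = (1 - θ) * (4 / 36) + θ * (2 / 16) := by
    rw [pUVθ_eq_of_card (n := 2) (by decide)]; norm_num [abs_of_nonneg, abs_of_neg]
  have ac10 : pUVθ ssA ssC 10 θ = (1 - θ) * (3 / 36) + θ * (2 / 16) := by
    rw [pUVθ_eq_of_card (n := 2) (by decide)]; norm_num [abs_of_nonneg, abs_of_neg]
  have ab6 : pUVθ ssA ssB 6 θ = (1 - θ) * (5 / 36) + θ * (3 / 16) := by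
    rw [pUVθ_eq_of_card (n := 3) (by decide)]; norm_num [abs_of_nonneg, abs_of_neg]
  have ab7 : pUVθ ssA ssB 7 θ = (1 - θ) * (6 / 36) + θ * (2 / 16) := by
    rw [pUVθ_eq_of_card (n := 2) (by decide)]; norm_num [abs_of_nonneg, abs_of_neg]
  have ab8 : pUVθ ssA ssB 8 θ = (1 - θ) * (5 / 36) + θ * (3 / 16) := by
    rw [pUVθ_eq_of_card (n := 3) (by decide)]; norm_num [abs_of_nonneg, abs_of_neg]
  have dAC (x : ℕ) (hx : pUVθ ssA ssC x θ = (1 - θ) * (3 / 36) + θ * (2 / 16)) :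
      pUVθ ssA ssC x θ + pUVθ ssA ssC 7 θ = 1 / 4 := by
    rw [hx, ac7]; ring
  have dAC' (x : ℕ) (hx : pUVθ ssA ssC x θ = (1 - θ) * (4 / 36) + θ * (2 / 16)) :
      pUVθ ssA ssC x θ + pUVθ ssA ssC 7 θ = (10 - θ) / 36 := by
    rw [hx, ac7]; ring
  have dAB (x : ℕ) (hx : pUVθ ssA ssB x θ = (1 - θ) * (5 / 36) + θ * (3 / 16)) :
      pUVθ ssA ssB x θ + pUVθ ssA ssB 7 θ = (44 + θ) / 144 := by
    rw [hx, ab7]; ring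
  rw [Finset.sum_insert (by decide), Finset.sum_insert (by decide), Finset.sum_insert (by decide),
    Finset.sum_singleton, Finset.sum_insert (by decide), Finset.sum_singleton,
    dAC 4 ac4, dAC' 5 ac5, dAC' 9 ac9, dAC 10 ac10, dAB 6 ab6, dAB 8 ab8,
    aa4, aa5, aa6, aa7, aa8, aa9, aa10, aa11, ac4, ac5, ac9, ac10, ab6, ab8]
  field_simp
  ring
end

section
/- The quartic polynomial 448 − 10064θ + 72θ² + 68θ³ − θ⁴ has exactly one root θ₀ in the interval (0,1), and this root satisfies 0.0445 < θ₀ < 0.0446; consequently, under the Smith–Scott model the expected pass-line gain −(448 − 10064θ + 72θ² + 68θ³ − θ⁴)/(72(10−θ)(44+θ)) is negative for θ ∈ [0,θ₀) and positive for θ ∈ (θ₀,1]. -/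
/-- Under the Smith–Scott model, the expected gain from a one-unit pass-line bet
under the optimal strategy, as a function of the control parameter `θ`. -/
noncomputable def ssGain (θ : ℝ) : ℝ :=
  -(448 - 10064 * θ + 72 * θ ^ 2 + 68 * θ ^ 3 - θ ^ 4) / (72 * (10 - θ) * (44 + θ))

/-- The quartic `448 − 10064θ + 72θ² + 68θ³ − θ⁴` is strictly decreasing on `[0,1]`. -/
theorem strictAntiOn_breakevenQuartic :
    StrictAntiOn (fun θ : ℝ => 448 - 10064 * θ + 72 * θ ^ 2 + 68 * θ ^ 3 - θ ^ 4)
      (Set.Icc 0 1) := by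
  rintro x ⟨hx0, hx1⟩ y ⟨hy0, hy1⟩ hxy
  have hxx : x ^ 2 ≤ 1 := pow_le_one₀ hx0 hx1
  have hyy : y ^ 2 ≤ 1 := pow_le_one₀ hy0 hy1
  have hxy1 : x * y ≤ 1 := mul_le_one₀ hx1 hy0 hy1
  have hpos : 0 ≤ (x + y) * (x ^ 2 + y ^ 2) := by positivity
  have hslope : 0 < 10064 - 72 * (x + y) - 68 * (x ^ 2 + x * y + y ^ 2)
      + (x + y) * (x ^ 2 + y ^ 2) := by linarith
  have := mul_pos (sub_pos.2 hxy) hslope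
  dsimp only
  linarith

theorem ssGain_denom_pos {θ : ℝ} (h0 : 0 ≤ θ) (h1 : θ ≤ 1) :
    0 < 72 * (10 - θ) * (44 + θ) :=
  mul_pos (by linarith) (by linarith)

/-- The quartic `448 − 10064θ + 72θ² + 68θ³ − θ⁴` has a unique root `θ₀` in `(0,1)`,
which lies in `(0.0445, 0.0446)`; the Smith–Scott expected pass-line gain is negative
for `θ ∈ [0, θ₀)` and positive for `θ ∈ (θ₀, 1]`. -/
theorem smith_scott_breakeven :
    ∃ θ₀ ∈ Set.Ioo (0 : ℝ) 1,
      (448 - 10064 * θ₀ + 72 * θ₀ ^ 2 + 68 * θ₀ ^ 3 - θ₀ ^ 4 = 0) ∧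
      (∀ θ ∈ Set.Ioo (0 : ℝ) 1,
        448 - 10064 * θ + 72 * θ ^ 2 + 68 * θ ^ 3 - θ ^ 4 = 0 → θ = θ₀) ∧
      (0.0445 < θ₀ ∧ θ₀ < 0.0446) ∧
      (∀ θ ∈ Set.Ico (0 : ℝ) θ₀, ssGain θ < 0) ∧
      (∀ θ ∈ Set.Ioc θ₀ (1 : ℝ), 0 < ssGain θ) := by
  have anti := strictAntiOn_breakevenQuartic
  obtain ⟨r, ⟨hr1, hr2⟩, hr⟩ := intermediate_value_Ioo' (a := (0.0445 : ℝ)) (b := 0.0446)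
    (f := fun θ : ℝ => 448 - 10064 * θ + 72 * θ ^ 2 + 68 * θ ^ 3 - θ ^ 4)
    (by norm_num) (by fun_prop) (show (0 : ℝ) ∈ _ by constructor <;> norm_num)
  have hr0 : 0 < r := by linarith
  have hr_lt : r < 1 := by linarith
  have hmem : r ∈ Set.Icc (0 : ℝ) 1 := ⟨hr0.le, hr_lt.le⟩
  refine ⟨r, ⟨hr0, hr_lt⟩, hr, fun θ hθ h => ?_, ⟨hr1, hr2⟩, ?_, ?_⟩
  · exact anti.injOn ⟨hθ.1.le, hθ.2.le⟩ hmem (h.trans hr.symm)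
  · rintro θ ⟨h0, hlt⟩
    have h1 : θ ≤ 1 := (hlt.trans hr_lt).le
    have := hr.symm.trans_lt (anti ⟨h0, h1⟩ hmem hlt)
    exact div_neg_of_neg_of_pos (neg_lt_zero.2 this) (ssGain_denom_pos h0 h1)
  · rintro θ ⟨hlt, h1⟩
    have h0 : 0 ≤ θ := (hr0.trans hlt).le
    have := (anti hmem ⟨h0, h1⟩ hlt).trans_eq hr
    exact div_pos (neg_pos.2 this) (ssGain_denom_pos h0 h1)
end

section
/- Under the Wong–Shackleford model, for every θ ∈ [0,1], the expected gain from a one-unit pass-line bet using the Sevens Set (1,5,6,2) on come-out rolls and the Hard Ways Set (2,4,2,4) on point rolls satisfies 2·[ p_{1562}(7,θ) + p_{1562}(11,θ) + Σ_{x∈{4,5,6,8,9,10}} p_{1562}(x,θ)·p_{2424}(x,θ)/(p_{2424}(x,θ)+p_{2424}(7,θ)) ] − 1 = −(21 − 682θ + 361θ² − 42θ³)/(27(5−2θ)(11−3θ)). -/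
/-- Wong–Shackleford model: distribution of dice totals for the dice set `(a,b,c,d)`
with skill factor `θ`. -/
noncomputable def pWS (a b c d : ℕ) (x : ℕ) (θ : ℝ) : ℝ :=
  (6 - |(x : ℝ) - 7|) / 36
    + θ / 36 * ((if a + c = x then 1 else 0) + (if b + d = x then 1 else 0)
      + (if (7 - a) + (7 - c) = x then 1 else 0) + (if (7 - b) + (7 - d) = x then 1 else 0))
    - θ / 36 * ((if a + (7 - c) = x then 1 else 0) + (if b + (7 - d) = x then 1 else 0)
      + (if (7 - a) + c = x then 1 else 0) + (if (7 - b) + d = x then 1 else 0))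

/-- Under the Wong–Shackleford model, the expected gain from a one-unit pass-line bet
using the Sevens Set `(1,5,6,2)` on come-out rolls and the Hard Ways Set `(2,4,2,4)`
on point rolls. -/
theorem wong_shackleford_expected_gain (θ : ℝ) (hθ : θ ∈ Set.Icc (0 : ℝ) 1) :
    2 * (pWS 1 5 6 2 7 θ + pWS 1 5 6 2 11 θ +
        (∑ x ∈ ({4, 5, 6, 8, 9, 10} : Finset ℕ), pWS 1 5 6 2 x θ *
          (pWS 2 4 2 4 x θ / (pWS 2 4 2 4 x θ + pWS 2 4 2 4 7 θ)))) - 1 =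
      -(21 - 682 * θ + 361 * θ ^ 2 - 42 * θ ^ 3) / (27 * (5 - 2 * θ) * (11 - 3 * θ)) := by
  obtain ⟨-, hθ1⟩ := hθ
  have h3 : 3 - θ ≠ 0 := by intro h; linarith
  have h5 : 5 - 2 * θ ≠ 0 := by intro h; linarith
  have h11 : 11 - θ * 3 ≠ 0 := by intro h; linarith
  have q4 : pWS 2 4 2 4 4 θ = (3 + θ) / 36 := by norm_num [pWS, abs_of_neg]; ring
  have q5 : pWS 2 4 2 4 5 θ = 4 / 36 := by norm_num [pWS, abs_of_neg]
  have q6 : pWS 2 4 2 4 6 θ = (5 + θ) / 36 := by norm_num [pWS, abs_of_neg]; ring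
  have q7 : pWS 2 4 2 4 7 θ = (6 - 4 * θ) / 36 := by norm_num [pWS]; ring
  have q8 : pWS 2 4 2 4 8 θ = (5 + θ) / 36 := by norm_num [pWS]; ring
  have q9 : pWS 2 4 2 4 9 θ = 4 / 36 := by norm_num [pWS]
  have q10 : pWS 2 4 2 4 10 θ = (3 + θ) / 36 := by norm_num [pWS]; ring
  have p4 : pWS 1 5 6 2 4 θ = (3 - θ) / 36 := by norm_num [pWS, abs_of_neg]; ring
  have p5 : pWS 1 5 6 2 5 θ = 4 / 36 := by norm_num [pWS, abs_of_neg]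
  have p6 : pWS 1 5 6 2 6 θ = 5 / 36 := by norm_num [pWS, abs_of_neg]
  have p7 : pWS 1 5 6 2 7 θ = (6 + 4 * θ) / 36 := by norm_num [pWS]; ring
  have p8 : pWS 1 5 6 2 8 θ = 5 / 36 := by norm_num [pWS]
  have p9 : pWS 1 5 6 2 9 θ = 4 / 36 := by norm_num [pWS]
  have p10 : pWS 1 5 6 2 10 θ = (3 - θ) / 36 := by norm_num [pWS]; ring
  have p11 : pWS 1 5 6 2 11 θ = 2 / 36 := by norm_num [pWS]
  have r4 : (3 + θ) / 36 / ((3 + θ) / 36 + (6 - 4 * θ) / 36) = (3 + θ) / (3 * (3 - θ)) := by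
    rw [← add_div, div_div_div_cancel_right₀ (by norm_num)]; ring_nf
  have r5 : (4 : ℝ) / 36 / (4 / 36 + (6 - 4 * θ) / 36) = 4 / (2 * (5 - 2 * θ)) := by
    rw [← add_div, div_div_div_cancel_right₀ (by norm_num)]; ring_nf
  have r6 : (5 + θ) / 36 / ((5 + θ) / 36 + (6 - 4 * θ) / 36) = (5 + θ) / (11 - 3 * θ) := by
    rw [← add_div, div_div_div_cancel_right₀ (by norm_num)]; ring_nf
  simp only [Finset.sum_insert, Finset.sum_singleton, Finset.mem_insert, Finset.mem_singleton,
    Nat.reduceEqDiff, or_self, not_false_eq_true,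
    q4, q5, q6, q7, q8, q9, q10, p4, p5, p6, p7, p8, p9, p10, p11, r4, r5, r6]
  field_simp
  ring
end

section
/- The cubic polynomial 21 − 682θ + 361θ² − 42θ³ has exactly one root θ₀ in the interval (0,1), and this root satisfies 0.0313 < θ₀ < 0.0314; consequently, under the Wong–Shackleford model the expected pass-line gain −(21 − 682θ + 361θ² − 42θ³)/(27(5−2θ)(11−3θ)) is negative for θ ∈ [0,θ₀) and positive for θ ∈ (θ₀,1]. -/
/-- Under the Wong–Shackleford model, the expected gain from a one-unit pass-line bet
under the optimal strategy, as a function of the skill factor `θ`. -/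
noncomputable def wsGain (θ : ℝ) : ℝ :=
  -(21 - 682 * θ + 361 * θ ^ 2 - 42 * θ ^ 3) / (27 * (5 - 2 * θ) * (11 - 3 * θ))

theorem strictAntiOn_breakevenCubic :
    StrictAntiOn (fun θ : ℝ => 21 - 682 * θ + 361 * θ ^ 2 - 42 * θ ^ 3) (Set.Icc 0 1) := by
  rintro x ⟨hx0, hx1⟩ y ⟨hy0, hy1⟩ hxy
  have h : 0 < 682 - 361 * (x + y) + 42 * (x ^ 2 + x * y + y ^ 2) := by
    nlinarith [sq_nonneg (x - y), sq_nonneg (x + y - 2)]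
  have := mul_pos (sub_pos.2 hxy) h
  dsimp only
  linarith

theorem wsGain_denominator_pos {θ : ℝ} (hθ : θ ≤ 1) :
    0 < 27 * (5 - 2 * θ) * (11 - 3 * θ) :=
  mul_pos (by linarith) (by linarith)

/-- The cubic `21 − 682θ + 361θ² − 42θ³` has a unique root `θ₀` in `(0,1)`, which lies
in `(0.0313, 0.0314)`; the Wong–Shackleford expected pass-line gain is negative for
`θ ∈ [0, θ₀)` and positive for `θ ∈ (θ₀, 1]`. -/
theorem wong_shackleford_breakeven :
    ∃ θ₀ ∈ Set.Ioo (0 : ℝ) 1,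
      (21 - 682 * θ₀ + 361 * θ₀ ^ 2 - 42 * θ₀ ^ 3 = 0) ∧
      (∀ θ ∈ Set.Ioo (0 : ℝ) 1,
        21 - 682 * θ + 361 * θ ^ 2 - 42 * θ ^ 3 = 0 → θ = θ₀) ∧
      (0.0313 < θ₀ ∧ θ₀ < 0.0314) ∧
      (∀ θ ∈ Set.Ico (0 : ℝ) θ₀, wsGain θ < 0) ∧
      (∀ θ ∈ Set.Ioc θ₀ (1 : ℝ), 0 < wsGain θ) := by
  have hcont : ContinuousOn (fun θ : ℝ => 21 - 682 * θ + 361 * θ ^ 2 - 42 * θ ^ 3)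
      (Set.Icc 0.0313 0.0314) := by fun_prop
  obtain ⟨θ₀, ⟨hlo, hhi⟩, hroot⟩ :=
    intermediate_value_Ioo' (by norm_num) hcont
      (show (0 : ℝ) ∈ Set.Ioo _ _ by constructor <;> norm_num)
  have hθ₀ : θ₀ ∈ Set.Ioo (0 : ℝ) 1 := by constructor <;> linarith
  have hmem := Set.Ioo_subset_Icc_self hθ₀
  refine ⟨θ₀, hθ₀, hroot, fun θ hθ h => ?_, ⟨hlo, hhi⟩, fun θ hθ => ?_, fun θ hθ => ?_⟩
  · exact strictAntiOn_breakevenCubic.injOn (Set.Ioo_subset_Icc_self hθ) hmem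
      (h.trans hroot.symm)
  · have hle : θ ≤ 1 := hθ.2.le.trans hmem.2
    have h := strictAntiOn_breakevenCubic ⟨hθ.1, hle⟩ hmem hθ.2
    exact div_neg_of_neg_of_pos (neg_lt_zero.2 (hroot.symm.trans_lt h))
      (wsGain_denominator_pos hle)
  · have h := strictAntiOn_breakevenCubic hmem ⟨hmem.1.trans hθ.1.le, hθ.2⟩ hθ.1
    exact div_pos (neg_pos.2 (h.trans_eq hroot)) (wsGain_denominator_pos hθ.2)
end

section
/- Under the Smith–Scott model, for every θ ∈ [0,1] the probability of making the point 4 using the AC set satisfies p_AC(4,θ)/(p_AC(4,θ)+p_AC(7,θ)) = (2+θ)/6 (which increases linearly from 1/3 at θ=0 to 1/2 at θ=1), and for every θ ∈ (0,1] and every other dice set UV ∈ {AA, AB, BB, BC, CC}, (2+θ)/6 > p_UV(4,θ)/(p_UV(4,θ)+p_UV(7,θ)). -/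
/-- Probability of making the point `x` with dice set `U`–`V`. -/
noncomputable def makePoint (U V : Finset ℕ) (x : ℕ) (θ : ℝ) : ℝ :=
  pUVθ U V x θ / (pUVθ U V x θ + pUVθ U V 7 θ)

theorem pSS_four : pSS 4 = 1 / 12 := by
  norm_num [pSS, abs_of_neg]

theorem pSS_seven : pSS 7 = 1 / 6 := by
  norm_num [pSS]

theorem pUVθ_nonneg {U V : Finset ℕ} {x : ℕ} {θ : ℝ} (hx : 0 ≤ pSS x) (h₀ : 0 ≤ θ)
    (h₁ : θ ≤ 1) : 0 ≤ pUVθ U V x θ := by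
  have : 0 ≤ 1 - θ := sub_nonneg.2 h₁
  unfold pUVθ pUV
  positivity

/-- If perfect control makes a total of 7 at least twice as likely as a total of 4, then the
probability of making the point 4 never exceeds its value `1 / 3` for fair dice. -/
theorem makePoint_four_le {U V : Finset ℕ} (h : 2 * pUV U V 4 ≤ pUV U V 7) {θ : ℝ}
    (h₀ : 0 ≤ θ) (h₁ : θ ≤ 1) : makePoint U V 4 θ ≤ 1 / 3 := by
  have h4 : 0 ≤ pUVθ U V 4 θ := pUVθ_nonneg (by norm_num [pSS_four]) h₀ h₁
  have h7 : 0 ≤ pUVθ U V 7 θ := pUVθ_nonneg (by norm_num [pSS_seven]) h₀ h₁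
  have key : 2 * pUVθ U V 4 θ ≤ pUVθ U V 7 θ := by
    simp only [pUVθ, pSS_four, pSS_seven]
    linarith [mul_le_mul_of_nonneg_left h h₀]
  exact div_le_of_le_mul₀ (add_nonneg h4 h7) (by norm_num) (by linarith)

theorem pUV_eq_of_card {U V : Finset ℕ} {x n : ℕ}
    (h : ((U ×ˢ V).filter (fun p => p.1 + p.2 = x)).card = n) : pUV U V x = n / 16 := by
  rw [pUV, h]

theorem two_mul_pUV_le_of_card {U V : Finset ℕ} {x y : ℕ}
    (h : 2 * ((U ×ˢ V).filter (fun p => p.1 + p.2 = x)).card ≤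
      ((U ×ˢ V).filter (fun p => p.1 + p.2 = y)).card) : 2 * pUV U V x ≤ pUV U V y := by
  have h' : (2 : ℝ) * ((U ×ˢ V).filter (fun p => p.1 + p.2 = x)).card ≤
      ((U ×ˢ V).filter (fun p => p.1 + p.2 = y)).card := by exact_mod_cast h
  unfold pUV
  linarith

/-- Under the Smith–Scott model, the probability of making the point 4 with the `AC`
set equals `(2+θ)/6`, and for `θ ∈ (0,1]` this strictly exceeds the corresponding
probability for every other dice set. -/
theorem smith_scott_point4_AC_optimal :
    (∀ θ ∈ Set.Icc (0 : ℝ) 1, makePoint ssA ssC 4 θ = (2 + θ) / 6) ∧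
    (∀ θ ∈ Set.Ioc (0 : ℝ) 1,
      (2 + θ) / 6 > makePoint ssA ssA 4 θ ∧
      (2 + θ) / 6 > makePoint ssA ssB 4 θ ∧
      (2 + θ) / 6 > makePoint ssB ssB 4 θ ∧
      (2 + θ) / 6 > makePoint ssB ssC 4 θ ∧
      (2 + θ) / 6 > makePoint ssC ssC 4 θ) := by
  refine ⟨fun θ _ => ?_, fun θ hθ => ?_⟩
  · have h4 : pUV ssA ssC 4 = (2 : ℕ) / 16 := pUV_eq_of_card (by decide)
    have h7 : pUV ssA ssC 7 = (2 : ℕ) / 16 := pUV_eq_of_card (by decide)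
    have hsum : pUVθ ssA ssC 4 θ + pUVθ ssA ssC 7 θ = 1 / 4 := by
      simp only [pUVθ, pSS_four, pSS_seven, h4, h7]
      push_cast
      ring
    rw [makePoint, hsum, pUVθ, pSS_four, h4]
    push_cast
    ring
  · have bound {U V : Finset ℕ} (h : 2 * pUV U V 4 ≤ pUV U V 7) :
        (2 + θ) / 6 > makePoint U V 4 θ :=
      (makePoint_four_le h hθ.1.le hθ.2).trans_lt (by linarith [hθ.1])
    refine ⟨bound ?_, bound ?_, bound ?_, bound ?_, bound ?_⟩ <;>
      exact two_mul_pUV_le_of_card (by decide)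
end

section
/- The maps σ₁, σ₂, σ₃ are bijections from D to D, the subgroup G of the permutation group of D that they generate has order 16, and the action of G on D has exactly 45 orbits. -/
/-- The set of dice sets `(a,b,c,d)`: `a,b,c,d ∈ {1,…,6}`, `b ∉ {a, 7−a}`,
`d ∉ {c, 7−c}`. -/
def diceD : Set (ℕ × ℕ × ℕ × ℕ) :=
  {p | p.1 ∈ Set.Icc 1 6 ∧ p.2.1 ∈ Set.Icc 1 6 ∧ p.2.2.1 ∈ Set.Icc 1 6 ∧
    p.2.2.2 ∈ Set.Icc 1 6 ∧ p.2.1 ≠ p.1 ∧ p.2.1 ≠ 7 - p.1 ∧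
    p.2.2.2 ≠ p.2.2.1 ∧ p.2.2.2 ≠ 7 - p.2.2.1}

/-- Rotation about the axis: `σ₁(a,b,c,d) = (b, 7−a, d, 7−c)`. -/
def diceσ₁ : ℕ × ℕ × ℕ × ℕ → ℕ × ℕ × ℕ × ℕ :=
  fun p => (p.2.1, 7 - p.1, p.2.2.2, 7 - p.2.2.1)

/-- Axis reversal: `σ₂(a,b,c,d) = (c, 7−d, a, 7−b)`. -/
def diceσ₂ : ℕ × ℕ × ℕ × ℕ → ℕ × ℕ × ℕ × ℕ :=
  fun p => (p.2.2.1, 7 - p.2.2.2, p.1, 7 - p.2.1)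

/-- Interchange of dice: `σ₃(a,b,c,d) = (c, d, a, b)`. -/
def diceσ₃ : ℕ × ℕ × ℕ × ℕ → ℕ × ℕ × ℕ × ℕ :=
  fun p => (p.2.2.1, p.2.2.2, p.1, p.2.1)

theorem mem_diceD {a b c d : ℕ} :
    (a, b, c, d) ∈ diceD ↔ (1 ≤ a ∧ a ≤ 6) ∧ (1 ≤ b ∧ b ≤ 6) ∧ (1 ≤ c ∧ c ≤ 6) ∧
      (1 ≤ d ∧ d ≤ 6) ∧ b ≠ a ∧ b ≠ 7 - a ∧ d ≠ c ∧ d ≠ 7 - c :=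
  Iff.rfl

theorem mapsTo_diceσ₁ : Set.MapsTo diceσ₁ diceD diceD := by
  rintro ⟨a, b, c, d⟩ h
  simp only [diceσ₁, mem_diceD] at h ⊢
  omega

theorem mapsTo_diceσ₂ : Set.MapsTo diceσ₂ diceD diceD := by
  rintro ⟨a, b, c, d⟩ h
  simp only [diceσ₂, mem_diceD] at h ⊢
  omega

theorem mapsTo_diceσ₃ : Set.MapsTo diceσ₃ diceD diceD := by
  rintro ⟨a, b, c, d⟩ h
  simp only [diceσ₃, mem_diceD] at h ⊢
  omega

theorem diceσ₁_iterate_four {p : ℕ × ℕ × ℕ × ℕ} (hp : p ∈ diceD) : diceσ₁^[4] p = p := by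
  obtain ⟨a, b, c, d⟩ := p
  rw [mem_diceD] at hp
  simp only [Function.iterate_succ, Function.iterate_zero, Function.comp_apply, id, diceσ₁,
    Prod.mk.injEq]
  omega

theorem diceσ₂_diceσ₂ {p : ℕ × ℕ × ℕ × ℕ} (hp : p ∈ diceD) : diceσ₂ (diceσ₂ p) = p := by
  obtain ⟨a, b, c, d⟩ := p
  rw [mem_diceD] at hp
  simp only [diceσ₂, Prod.mk.injEq]
  lia

theorem diceσ₃_diceσ₃ (p : ℕ × ℕ × ℕ × ℕ) : diceσ₃ (diceσ₃ p) = p :=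
  rfl

theorem diceσ₂_diceσ₁ {p : ℕ × ℕ × ℕ × ℕ} (hp : p ∈ diceD) :
    diceσ₂ (diceσ₁ p) = diceσ₁^[3] (diceσ₂ p) := by
  obtain ⟨a, b, c, d⟩ := p
  rw [mem_diceD] at hp
  simp only [Function.iterate_succ, Function.iterate_zero, Function.comp_apply, id, diceσ₁,
    diceσ₂, Prod.mk.injEq]
  lia

theorem bijOn_diceσ₁ : Set.BijOn diceσ₁ diceD diceD :=
  Set.InvOn.bijOn (f' := diceσ₁^[3])
    ⟨fun _ hp => diceσ₁_iterate_four hp, fun _ hp => diceσ₁_iterate_four hp⟩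
    mapsTo_diceσ₁ (mapsTo_diceσ₁.iterate 3)

theorem bijOn_diceσ₂ : Set.BijOn diceσ₂ diceD diceD :=
  Set.InvOn.bijOn (f' := diceσ₂)
    ⟨fun _ hp => diceσ₂_diceσ₂ hp, fun _ hp => diceσ₂_diceσ₂ hp⟩ mapsTo_diceσ₂ mapsTo_diceσ₂

theorem bijOn_diceσ₃ : Set.BijOn diceσ₃ diceD diceD :=
  Set.InvOn.bijOn (f' := diceσ₃)
    ⟨fun p _ => diceσ₃_diceσ₃ p, fun p _ => diceσ₃_diceσ₃ p⟩ mapsTo_diceσ₃ mapsTo_diceσ₃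

/-- The normal form `x ^ i * y ^ j * z ^ k` for elements of a quotient of `D₄ × C₂`. -/
def normalWord {G : Type*} [Group G] (x y z : G) (w : Fin 4 × Fin 2 × Fin 2) : G :=
  x ^ (w.1 : ℕ) * y ^ (w.2.1 : ℕ) * z ^ (w.2.2 : ℕ)

theorem closure_eq_range_normalWord {G : Type*} [Group G] {x y z : G} (hx : x ^ 4 = 1)
    (hy : y * y = 1) (hz : z * z = 1) (hyx : y * x = x ^ 3 * y) (hzx : Commute z x)
    (hzy : Commute z y) :
    (Subgroup.closure {x, y, z} : Set G) = Set.range (normalWord x y z) := by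
  have mul_x (w) : x * normalWord x y z w = normalWord x y z (w.1 + 1, w.2) := by
    have h : x ^ ((w.1 + 1 : Fin 4) : ℕ) = x * x ^ (w.1 : ℕ) := by
      rw [Fin.val_add, ← pow_succ', ← pow_eq_pow_mod _ hx]; rfl
    simp only [normalWord, h, mul_assoc]
  have pow_add_one {g : G} (hg : g * g = 1) (j : Fin 2) :
      g ^ ((j + 1 : Fin 2) : ℕ) = g * g ^ (j : ℕ) := by
    fin_cases j <;> simp [hg]
  have mul_z (w) : z * normalWord x y z w = normalWord x y z (w.1, w.2.1, w.2.2 + 1) := by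
    simp only [normalWord, pow_add_one hz, ← mul_assoc]
    rw [(hzx.pow_right _).eq, mul_assoc (x ^ _) z, (hzy.pow_right _).eq, ← mul_assoc]
  have mul_y (w) : y * normalWord x y z w = normalWord x y z (-w.1, w.2.1 + 1, w.2.2) := by
    have h : y * x ^ (w.1 : ℕ) = x ^ ((-w.1 : Fin 4) : ℕ) * y := by
      have hconj : SemiconjBy y x (x ^ 3) := hyx
      rw [(hconj.pow_right w.1).eq, ← pow_mul, pow_eq_pow_mod _ hx]
      congr 2
      generalize w.1 = i
      revert i
      decide
    simp only [normalWord, pow_add_one hy, ← mul_assoc, h]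
  have inv_x : x⁻¹ = x * (x * x) := by
    rw [inv_eq_iff_mul_eq_one, ← hx, pow_succ', pow_three]
  have inv_y : y⁻¹ = y := inv_eq_of_mul_eq_one_left hy
  have inv_z : z⁻¹ = z := inv_eq_of_mul_eq_one_left hz
  apply Set.Subset.antisymm
  · intro g hg
    induction hg using Subgroup.closure_induction_left with
    | one => exact ⟨(0, 0, 0), by simp [normalWord]⟩
    | mul_left g hg h _ ih =>
      obtain ⟨w, rfl⟩ := ih
      rcases hg with rfl | rfl | rfl
      · exact ⟨_, (mul_x w).symm⟩
      · exact ⟨_, (mul_y w).symm⟩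
      · exact ⟨_, (mul_z w).symm⟩
    | inv_mul_cancel g hg h _ ih =>
      obtain ⟨w, rfl⟩ := ih
      rcases hg with rfl | rfl | rfl
      · rw [inv_x, mul_assoc, mul_assoc, mul_x, mul_x, mul_x]
        exact ⟨_, rfl⟩
      · rw [inv_y]
        exact ⟨_, (mul_y w).symm⟩
      · rw [inv_z]
        exact ⟨_, (mul_z w).symm⟩
  · rintro _ ⟨w, rfl⟩
    have mem {g : G} (hg : g ∈ ({x, y, z} : Set G)) := Subgroup.subset_closure hg
    exact mul_mem (mul_mem (pow_mem (mem (by simp)) _) (pow_mem (mem (by simp)) _))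
      (pow_mem (mem (by simp)) _)

/-- The map of dice sets given by a word in the generators. -/
def diceWord (w : Fin 4 × Fin 2 × Fin 2) (p : ℕ × ℕ × ℕ × ℕ) : ℕ × ℕ × ℕ × ℕ :=
  diceσ₁^[w.1] (diceσ₂^[w.2.1] (diceσ₃^[w.2.2] p))

/-- The dice sets as a finset. -/
def diceFinset : Finset (ℕ × ℕ × ℕ × ℕ) :=
  (Finset.Icc 1 6 ×ˢ Finset.Icc 1 6 ×ˢ Finset.Icc 1 6 ×ˢ Finset.Icc 1 6).filter fun p =>
    p.2.1 ≠ p.1 ∧ p.2.1 ≠ 7 - p.1 ∧ p.2.2.2 ≠ p.2.2.1 ∧ p.2.2.2 ≠ 7 - p.2.2.1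

theorem mem_diceFinset {p : ℕ × ℕ × ℕ × ℕ} : p ∈ diceFinset ↔ p ∈ diceD := by
  simp [diceFinset, diceD, and_assoc]

theorem diceWord_injective_at : Function.Injective fun w => diceWord w (1, 2, 1, 3) := by
  decide +kernel

theorem sum_card_fixed_diceWord :
    ∑ w, (diceFinset.filter fun p => diceWord w p = p).card = 720 := by
  decide +kernel

/-- The maps `σ₁, σ₂, σ₃` are bijections of the set `D` of dice sets; the subgroup of
the permutation group of `D` that they generate has order 16, and its action on `D`
has exactly 45 orbits. -/
theorem dice_set_group_orbits :
    Set.BijOn diceσ₁ diceD diceD ∧ Set.BijOn diceσ₂ diceD diceD ∧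
    Set.BijOn diceσ₃ diceD diceD ∧
    ∃ e₁ e₂ e₃ : Equiv.Perm diceD,
      (∀ p : diceD, (e₁ p : ℕ × ℕ × ℕ × ℕ) = diceσ₁ p) ∧
      (∀ p : diceD, (e₂ p : ℕ × ℕ × ℕ × ℕ) = diceσ₂ p) ∧
      (∀ p : diceD, (e₃ p : ℕ × ℕ × ℕ × ℕ) = diceσ₃ p) ∧
      Nat.card (Subgroup.closure ({e₁, e₂, e₃} : Set (Equiv.Perm diceD))) = 16 ∧
      Nat.card
        (Quotient (MulAction.orbitRel
          (Subgroup.closure ({e₁, e₂, e₃} : Set (Equiv.Perm diceD))) diceD)) = 45 := by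
  refine ⟨bijOn_diceσ₁, bijOn_diceσ₂, bijOn_diceσ₃, bijOn_diceσ₁.equiv, bijOn_diceσ₂.equiv,
    bijOn_diceσ₃.equiv, fun _ => rfl, fun _ => rfl, fun _ => rfl, ?_⟩
  set e₁ : Equiv.Perm diceD := bijOn_diceσ₁.equiv
  set e₂ : Equiv.Perm diceD := bijOn_diceσ₂.equiv
  set e₃ : Equiv.Perm diceD := bijOn_diceσ₃.equiv
  have coe_pow {f : ℕ × ℕ × ℕ × ℕ → ℕ × ℕ × ℕ × ℕ} {e : Equiv.Perm diceD}
      (he : ∀ p, (e p : ℕ × ℕ × ℕ × ℕ) = f p) (n : ℕ) (p : diceD) :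
      ((e ^ n) p : ℕ × ℕ × ℕ × ℕ) = f^[n] p := by
    induction n with
    | zero => rfl
    | succ n ih => rw [pow_succ', Equiv.Perm.mul_apply, he, ih, Function.iterate_succ_apply']
  have coe_word (w) (p : diceD) :
      (normalWord e₁ e₂ e₃ w p : ℕ × ℕ × ℕ × ℕ) = diceWord w p := by
    simp only [normalWord, Equiv.Perm.mul_apply, diceWord]
    rw [coe_pow (f := diceσ₁) fun _ => rfl, coe_pow (f := diceσ₂) fun _ => rfl,
      coe_pow (f := diceσ₃) fun _ => rfl]
  have hrange := closure_eq_range_normalWord (x := e₁) (y := e₂) (z := e₃)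
    (Equiv.ext fun p => Subtype.ext (diceσ₁_iterate_four p.2))
    (Equiv.ext fun p => Subtype.ext (diceσ₂_diceσ₂ p.2))
    (Equiv.ext fun p => Subtype.ext (diceσ₃_diceσ₃ p))
    (Equiv.ext fun p => Subtype.ext (diceσ₂_diceσ₁ p.2))
    (Equiv.ext fun _ => rfl) (Equiv.ext fun _ => rfl)
  have hinj : Function.Injective (normalWord e₁ e₂ e₃) := fun v w h =>
    diceWord_injective_at <| by
      have hp : (1, 2, 1, 3) ∈ diceD := by simp [mem_diceD]
      simpa only [coe_word] using congrArg (fun e => (e ⟨_, hp⟩ : ℕ × ℕ × ℕ × ℕ)) h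
  set G := Subgroup.closure ({e₁, e₂, e₃} : Set (Equiv.Perm diceD))
  let E : Fin 4 × Fin 2 × Fin 2 ≃ G :=
    (Equiv.ofInjective _ hinj).trans (Equiv.setCongr hrange.symm)
  have hcard : Nat.card G = 16 := by
    rw [← Nat.card_congr E]; simp
  refine ⟨hcard, ?_⟩
  classical
  have : Fintype diceD := Fintype.ofFinset diceFinset fun _ => mem_diceFinset
  have : Fintype G := Fintype.ofEquiv _ E
  have hfixed (w) : Fintype.card (MulAction.fixedBy diceD (E w)) =
      (diceFinset.filter fun p => diceWord w p = p).card := by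
    have key (p : diceD) : p ∈ MulAction.fixedBy diceD (E w) ↔ diceWord w p = p := by
      rw [← coe_word, Subtype.coe_inj]; rfl
    rw [← Fintype.card_coe]
    exact Fintype.card_congr
      { toFun p := ⟨p, Finset.mem_filter.2 ⟨mem_diceFinset.2 p.1.2, (key _).1 p.2⟩⟩
        invFun p := ⟨⟨p, mem_diceFinset.1 (Finset.mem_filter.1 p.2).1⟩,
          (key _).2 (Finset.mem_filter.1 p.2).2⟩
        left_inv _ := rfl
        right_inv _ := rfl }
  have : Fintype (Quotient (MulAction.orbitRel G diceD)) := Fintype.ofFinite _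
  have burnside := MulAction.sum_card_fixedBy_eq_card_orbits_mul_card_group G diceD
  rw [← E.sum_comp, Finset.sum_congr rfl fun w _ => hfixed w, sum_card_fixed_diceWord,
    ← Nat.card_eq_fintype_card (α := G), hcard, ← Nat.card_eq_fintype_card] at burnside
  omega
end

section
/- Under the Smith–Scott model, for every θ ∈ [0,1] the matrix I₄ − Q_θ is invertible, and with M_θ = (I₄ − Q_θ)⁻¹ the mean length of the shooter's hand satisfies (M_θ·𝟙)_co = 24(8912 + 132θ − 54θ² + θ³)/((4−θ)(8+θ)(28−θ)²). -/
/-- Smith–Scott Markov chain transition matrix, states `(co, p4-10, p5-9, p6-8, 7o)`. -/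
noncomputable def ssP (θ : ℝ) : Matrix (Fin 5) (Fin 5) ℝ :=
  (1 / 144 : ℝ) •
    !![12 * (4 - θ), 6 * (4 - θ), 4 * (8 + θ), 2 * (20 + 7 * θ), 0;
       6 * (2 + θ), 108, 0, 0, 6 * (4 - θ);
       2 * (8 + θ), 0, 4 * (26 + θ), 0, 6 * (4 - θ);
       20 + 7 * θ, 0, 0, 100 - θ, 6 * (4 - θ);
       0, 0, 0, 0, 144]

/-- Upper-left `4 × 4` submatrix of `ssP θ` (transient states). -/
noncomputable def ssQ (θ : ℝ) : Matrix (Fin 4) (Fin 4) ℝ :=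
  (ssP θ).submatrix Fin.castSucc Fin.castSucc

/-- The all-ones vector `𝟙 = (1,1,1,1)ᵀ`. -/
def onesVec : Fin 4 → ℝ := fun _ => 1

theorem one_sub_ssQ (θ : ℝ) :
    1 - ssQ θ = (1 / 144 : ℝ) •
      !![96 + 12 * θ, -(6 * (4 - θ)), -(4 * (8 + θ)), -(2 * (20 + 7 * θ));
         -(6 * (2 + θ)), 36, 0, 0;
         -(2 * (8 + θ)), 0, 40 - 4 * θ, 0;
         -(20 + 7 * θ), 0, 0, 44 + θ] := by
  ext i j
  fin_cases i <;> fin_cases j <;> simp [ssQ, ssP] <;> ring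

theorem det_one_sub_ssQ (θ : ℝ) :
    (1 - ssQ θ).det = (4 - θ) * (8 + θ) * (28 - θ) ^ 2 / 144 ^ 3 := by
  rw [one_sub_ssQ, Matrix.det_smul]
  simp [Matrix.det_succ_row_zero, Fin.sum_univ_succ, Fin.succAbove]
  ring

/-- Under the Smith–Scott model, `I₄ − Q_θ` is invertible and the mean hand length
`(M_θ 𝟙)_co` with `M_θ = (I₄ − Q_θ)⁻¹` equals the stated rational function of `θ`. -/
theorem smith_scott_mean_hand_length (θ : ℝ) (hθ : θ ∈ Set.Icc (0 : ℝ) 1) :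
    IsUnit (1 - ssQ θ) ∧
    Matrix.mulVec (1 - ssQ θ)⁻¹ onesVec 0 =
      24 * (8912 + 132 * θ - 54 * θ ^ 2 + θ ^ 3) /
        ((4 - θ) * (8 + θ) * (28 - θ) ^ 2) := by
  obtain ⟨h0, h1⟩ := hθ
  have h4 : 4 - θ ≠ 0 := by linarith
  have h8 : 8 + θ ≠ 0 := by linarith
  have h28 : 28 - θ ≠ 0 := by linarith
  have h10 : 10 - θ ≠ 0 := by linarith
  have h44 : 44 + θ ≠ 0 := by linarith
  have hdet : IsUnit (1 - ssQ θ).det := by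
    rw [det_one_sub_ssQ, isUnit_iff_ne_zero]
    positivity
  refine ⟨(Matrix.isUnit_iff_isUnit_det _).2 hdet, ?_⟩
  set E := 24 * (8912 + 132 * θ - 54 * θ ^ 2 + θ ^ 3) /
    ((4 - θ) * (8 + θ) * (28 - θ) ^ 2) with hE
  have hv : (1 - ssQ θ).mulVec ![E, (144 + 6 * (2 + θ) * E) / 36,
      (144 + 2 * (8 + θ) * E) / (4 * (10 - θ)), (144 + (20 + 7 * θ) * E) / (44 + θ)] =
      onesVec := by
    rw [one_sub_ssQ]
    ext i
    fin_cases i <;> simp [onesVec, Matrix.mulVec, dotProduct, Fin.sum_univ_succ]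
    · rw [hE]
      field_simp
      ring
    all_goals
      field_simp
      ring
  rw [← hv, Matrix.mulVec_mulVec, Matrix.nonsing_inv_mul _ hdet, Matrix.one_mulVec]
  rfl
end

section
/- Under the Wong–Shackleford model, for every θ ∈ [0,1] the matrix I₄ − Q_θ is invertible, and with M_θ = (I₄ − Q_θ)⁻¹ the mean length of the shooter's hand satisfies (M_θ·𝟙)_co = 9(557 − 281θ + 30θ²)/((3−2θ)(196 − 85θ + 6θ²)). -/
/-- Wong–Shackleford Markov chain transition matrix, states `(co, p4-10, p5-9, p6-8, 7o)`. -/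
noncomputable def wsP (θ : ℝ) : Matrix (Fin 5) (Fin 5) ℝ :=
  (1 / 36 : ℝ) •
    !![2 * (6 + θ), 2 * (3 - θ), 8, 10, 0;
       3 + θ, 3 * (9 + θ), 0, 0, 2 * (3 - 2 * θ);
       4, 0, 2 * (13 + 2 * θ), 0, 2 * (3 - 2 * θ);
       5 + θ, 0, 0, 25 + 3 * θ, 2 * (3 - 2 * θ);
       0, 0, 0, 0, 36]

/-- Upper-left `4 × 4` submatrix of `wsP θ` (transient states). -/
noncomputable def wsQ (θ : ℝ) : Matrix (Fin 4) (Fin 4) ℝ :=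
  (wsP θ).submatrix Fin.castSucc Fin.castSucc

theorem one_sub_wsQ (θ : ℝ) :
    1 - wsQ θ = !![(24 - 2 * θ) / 36, -(2 * (3 - θ)) / 36, -8 / 36, -10 / 36;
      -(3 + θ) / 36, (9 - 3 * θ) / 36, 0, 0;
      -4 / 36, 0, (10 - 4 * θ) / 36, 0;
      -(5 + θ) / 36, 0, 0, (11 - 3 * θ) / 36] := by
  ext i j
  fin_cases i <;> fin_cases j <;> simp [wsQ, wsP] <;> ring

theorem det_one_sub_wsQ (θ : ℝ) :
    (1 - wsQ θ).det =
      8 * (3 - θ) * (3 - 2 * θ) * (196 - 85 * θ + 6 * θ ^ 2) / 36 ^ 4 := by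
  rw [one_sub_wsQ]
  simp [Matrix.det_succ_row_zero, Fin.sum_univ_succ, Fin.succAbove]
  ring

/-- The mean absorption times solve the first-step equations. -/
theorem one_sub_wsQ_mulVec {θ x y z w : ℝ} (h₂ : 10 - 4 * θ ≠ 0) (h₃ : 11 - 3 * θ ≠ 0)
    (hx : x * ((3 - 2 * θ) * (196 - 85 * θ + 6 * θ ^ 2)) =
      9 * (557 - 281 * θ + 30 * θ ^ 2))
    (hy : y * (9 - 3 * θ) = 36 + (3 + θ) * x) (hz : z * (10 - 4 * θ) = 36 + 4 * x)
    (hw : w * (11 - 3 * θ) = 36 + (5 + θ) * x) :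
    Matrix.mulVec (1 - wsQ θ) ![x, y, z, w] = onesVec := by
  have h : (24 - 2 * θ) * x - 2 * (3 - θ) * y - 8 * z - 10 * w = 36 := by
    apply mul_left_cancel₀ (mul_ne_zero h₂ h₃)
    linear_combination (8 / 3) * hx - (2 / 3) * (10 - 4 * θ) * (11 - 3 * θ) * hy -
      8 * (11 - 3 * θ) * hz - 10 * (10 - 4 * θ) * hw
  rw [one_sub_wsQ]
  ext i
  fin_cases i <;> simp [Matrix.mulVec, dotProduct, Fin.sum_univ_succ, onesVec]
  · linear_combination h / 36
  · linear_combination hy / 36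
  · linear_combination hz / 36
  · linear_combination hw / 36

/-- Under the Wong–Shackleford model, `I₄ − Q_θ` is invertible and the mean hand
length `(M_θ 𝟙)_co` with `M_θ = (I₄ − Q_θ)⁻¹` equals the stated rational function. -/
theorem wong_shackleford_mean_hand_length (θ : ℝ) (hθ : θ ∈ Set.Icc (0 : ℝ) 1) :
    IsUnit (1 - wsQ θ) ∧
    Matrix.mulVec (1 - wsQ θ)⁻¹ onesVec 0 =
      9 * (557 - 281 * θ + 30 * θ ^ 2) /
        ((3 - 2 * θ) * (196 - 85 * θ + 6 * θ ^ 2)) := by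
  obtain ⟨h0, h1⟩ := hθ
  have hq : 0 < 196 - 85 * θ + 6 * θ ^ 2 := by nlinarith
  have hl : 0 < 3 - 2 * θ := by linarith
  have hdet : IsUnit (1 - wsQ θ).det := by
    rw [det_one_sub_wsQ, isUnit_iff_ne_zero]
    have : 0 < 3 - θ := by linarith
    positivity
  refine ⟨(Matrix.isUnit_iff_isUnit_det _).2 hdet, ?_⟩
  have h₁ : 9 - 3 * θ ≠ 0 := by linarith
  have h₂ : 10 - 4 * θ ≠ 0 := by linarith
  have h₃ : 11 - 3 * θ ≠ 0 := by linarith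
  rw [← one_sub_wsQ_mulVec h₂ h₃ (div_mul_cancel₀ _ (mul_pos hl hq).ne')
    (div_mul_cancel₀ _ h₁) (div_mul_cancel₀ _ h₂) (div_mul_cancel₀ _ h₃),
    Matrix.mulVec_mulVec, Matrix.nonsing_inv_mul _ hdet, Matrix.one_mulVec]
  rfl
end

section
/- The function θ ↦ 24(8912 + 132θ − 54θ² + θ³)/((4−θ)(8+θ)(28−θ)²) is strictly increasing on [0,1], with value 1671/196 at θ = 0 and value 296/27 at θ = 1. -/
/-- The Smith–Scott mean hand length `24(8912 + 132θ − 54θ² + θ³)/((4−θ)(8+θ)(28−θ)²)`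
is strictly increasing on `[0,1]`, with value `1671/196` at `θ = 0` and `296/27` at
`θ = 1`. -/
theorem smith_scott_mean_strict_mono :
    StrictMonoOn
      (fun θ : ℝ => 24 * (8912 + 132 * θ - 54 * θ ^ 2 + θ ^ 3) /
        ((4 - θ) * (8 + θ) * (28 - θ) ^ 2)) (Set.Icc (0 : ℝ) 1) ∧
    24 * (8912 + 132 * (0 : ℝ) - 54 * (0 : ℝ) ^ 2 + (0 : ℝ) ^ 3) /
        ((4 - 0) * (8 + 0) * (28 - 0) ^ 2) = 1671 / 196 ∧
    24 * (8912 + 132 * (1 : ℝ) - 54 * (1 : ℝ) ^ 2 + (1 : ℝ) ^ 3) /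
        ((4 - 1) * (8 + 1) * (28 - 1) ^ 2) = 296 / 27 := by
  refine ⟨?_, by norm_num, by norm_num⟩
  rintro x ⟨hx0, hx1⟩ y ⟨hy0, hy1⟩ hxy
  have hnum : 8912 + 132 * x - 54 * x ^ 2 + x ^ 3 < 8912 + 132 * y - 54 * y ^ 2 + y ^ 3 := by
    have hquot : 0 < 132 - 54 * (x + y) + (x ^ 2 + x * y + y ^ 2) := by
      nlinarith [sq_nonneg x, sq_nonneg y, mul_nonneg hx0 hy0]
    nlinarith [mul_pos (sub_pos.2 hxy) hquot]
  have hquad : (4 - y) * (8 + y) ≤ (4 - x) * (8 + x) := by nlinarith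
  have hsq : (28 - y) ^ 2 ≤ (28 - x) ^ 2 := by
    gcongr
    linarith
  have hquad_pos : 0 < (4 - y) * (8 + y) := mul_pos (by linarith) (by linarith)
  have hsq_pos : 0 < (28 - y) ^ 2 := pow_pos (by linarith) 2
  have hnum_nonneg : 0 ≤ 8912 + 132 * y - 54 * y ^ 2 + y ^ 3 := by
    nlinarith [pow_nonneg hy0 3]
  exact div_lt_div₀ (by linarith)
    (mul_le_mul hquad hsq hsq_pos.le (hquad_pos.le.trans hquad))
    (by linarith) (mul_pos hquad_pos hsq_pos)
end

section
/- For all real θ and z, the characteristic polynomial of the Smith–Scott transition matrix satisfies det(z·I₅ − P_θ) = (z − 1)·(2985984 z⁴ − 186624(40−θ) z³ + 288(22904 − 1870θ − 55θ²) z² − 12(195424 − 40920θ − 2124θ² − 19θ³) z + (252800 − 144032θ − 10176θ² − 176θ³ − θ⁴))/2985984. -/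
/-- Characteristic polynomial of the Smith–Scott transition matrix:
`det(z I₅ − P_θ) = (z − 1) · (quartic in z)/2985984`. -/
theorem smith_scott_char_poly (θ z : ℝ) :
    (z • (1 : Matrix (Fin 5) (Fin 5) ℝ) - ssP θ).det =
      (z - 1) *
        (2985984 * z ^ 4 - 186624 * (40 - θ) * z ^ 3
          + 288 * (22904 - 1870 * θ - 55 * θ ^ 2) * z ^ 2
          - 12 * (195424 - 40920 * θ - 2124 * θ ^ 2 - 19 * θ ^ 3) * z
          + (252800 - 144032 * θ - 10176 * θ ^ 2 - 176 * θ ^ 3 - θ ^ 4)) / 2985984 := by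
  simp [ssP, Matrix.det_succ_row_zero, Fin.sum_univ_succ, Fin.succAbove, Matrix.one_apply]
  ring
end

section
/- Under the Smith–Scott model, for every θ ∈ [0,1): the quartic polynomial 2985984 z⁴ − 186624(40−θ) z³ + 288(22904 − 1870θ − 55θ²) z² − 12(195424 − 40920θ − 2124θ² − 19θ³) z + (252800 − 144032θ − 10176θ² − 176θ³ − θ⁴) has four distinct real roots e₁ > e₂ > e₃ > e₄ satisfying 1 > e₁ > 108/144 > e₂ > (104+4θ)/144 > e₃ > (100−θ)/144 > e₄ > 0, and there exist real numbers c₁ > 0, c₂ < 0, c₃ < 0, c₄ < 0 such that c₁ + c₂ + c₃ + c₄ = 1, c₁e₁ + c₂e₂ + c₃e₃ + c₄e₄ = 1, and for every integer m ≥ 1, (P_θ^m)_{co,7o} = 1 − (c₁e₁^m + c₂e₂^m + c₃e₃^m + c₄e₄^m); equivalently, the distribution of the hand length L is a linear combination of four geometric distributions: P_θ(L = x) = Σᵢ cᵢ·eᵢ^{x−1}(1−eᵢ) for every integer x ≥ 2. -/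
/-- The quartic factor of the characteristic polynomial of `ssP θ`. -/
def ssQuartic (θ z : ℝ) : ℝ :=
  2985984 * z ^ 4 - 186624 * (40 - θ) * z ^ 3
    + 288 * (22904 - 1870 * θ - 55 * θ ^ 2) * z ^ 2
    - 12 * (195424 - 40920 * θ - 2124 * θ ^ 2 - 19 * θ ^ 3) * z
    + (252800 - 144032 * θ - 10176 * θ ^ 2 - 176 * θ ^ 3 - θ ^ 4)

open Matrix

section EigenExpansion

variable {n : Type*} [Fintype n]

/-- A real matrix with as many distinct eigenvalues as its size has a basis of eigenvectors, in
which its powers act diagonally. -/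
theorem Matrix.exists_pow_mulVec_eq_sum_of_injective_eigenvalues [DecidableEq n]
    {A : Matrix n n ℝ} {μ : n → ℝ} (hμ : Function.Injective μ) {v : n → n → ℝ}
    (hv : ∀ i, A *ᵥ v i = μ i • v i) (hv0 : ∀ i, v i ≠ 0) (x : n → ℝ) :
    ∃ c : n → ℝ, ∀ m : ℕ, (A ^ m) *ᵥ x = ∑ i, (c i * μ i ^ m) • v i := by
  have hli : LinearIndependent ℝ v :=
    Module.End.eigenvectors_linearIndependent' (Matrix.toLin' A) μ hμ v fun i =>
      ⟨Module.End.mem_eigenspace_iff.2 (by simpa using hv i), hv0 i⟩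
  have hspan : Submodule.span ℝ (Set.range v) = ⊤ :=
    hli.span_eq_top_of_card_eq_finrank' (by simp)
  obtain ⟨c, hc⟩ := (Submodule.mem_span_range_iff_exists_fun ℝ).1
    (hspan ▸ Submodule.mem_top : x ∈ Submodule.span ℝ (Set.range v))
  refine ⟨c, fun m => ?_⟩
  induction m with
  | zero => simp [hc]
  | succ m ih =>
    rw [pow_succ', ← Matrix.mulVec_mulVec, ih, Matrix.mulVec_sum]
    refine Finset.sum_congr rfl fun i _ => ?_
    rw [Matrix.mulVec_smul, hv, smul_smul, pow_succ, mul_assoc]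

/-- Left and right eigenvectors for distinct eigenvalues are orthogonal. -/
theorem Matrix.dotProduct_eq_zero_of_eigenvalue_ne {A : Matrix n n ℝ} {w v : n → ℝ} {r s : ℝ}
    (hw : w ᵥ* A = r • w) (hv : A *ᵥ v = s • v) (hrs : r ≠ s) : w ⬝ᵥ v = 0 := by
  have h := Matrix.dotProduct_mulVec w A v
  rw [hw, hv, dotProduct_smul, smul_dotProduct, smul_eq_mul, smul_eq_mul] at h
  have h' : (r - s) * (w ⬝ᵥ v) = 0 := by linear_combination -h
  exact (mul_eq_zero.1 h').resolve_left (sub_ne_zero.2 hrs)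

end EigenExpansion

/-- The eigenvector of `ssP θ` for a root `e` of the quartic. -/
noncomputable def ssRight (θ e : ℝ) : Fin 5 → ℝ :=
  ![1, 6 * (2 + θ) / 144 * (e - 108 / 144)⁻¹, 2 * (8 + θ) / 144 * (e - (104 + 4 * θ) / 144)⁻¹,
    (20 + 7 * θ) / 144 * (e - (100 - θ) / 144)⁻¹, 0]

/-- The sum of the transient coordinates of the left eigenvector `ssLeft θ e`. -/
noncomputable def ssLeftSum (θ e : ℝ) : ℝ :=
  1 + 6 * (4 - θ) / 144 * (e - 108 / 144)⁻¹ + 4 * (8 + θ) / 144 * (e - (104 + 4 * θ) / 144)⁻¹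
    + 2 * (20 + 7 * θ) / 144 * (e - (100 - θ) / 144)⁻¹

/-- The left eigenvector of `ssP θ` for a root `e` of the quartic. -/
noncomputable def ssLeft (θ e : ℝ) : Fin 5 → ℝ :=
  ![1, 6 * (4 - θ) / 144 * (e - 108 / 144)⁻¹, 4 * (8 + θ) / 144 * (e - (104 + 4 * θ) / 144)⁻¹,
    2 * (20 + 7 * θ) / 144 * (e - (100 - θ) / 144)⁻¹, -ssLeftSum θ e]

section Root

variable {θ e : ℝ}

theorem ssQuartic_secular (h : ssQuartic θ e = 0) (h₁ : e ≠ 108 / 144)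
    (h₂ : e ≠ (104 + 4 * θ) / 144) (h₃ : e ≠ (100 - θ) / 144) :
    e = 12 * (4 - θ) / 144 + 6 * (2 + θ) * (6 * (4 - θ)) / 144 ^ 2 * (e - 108 / 144)⁻¹
      + 2 * (8 + θ) * (4 * (8 + θ)) / 144 ^ 2 * (e - (104 + 4 * θ) / 144)⁻¹
      + (20 + 7 * θ) * (2 * (20 + 7 * θ)) / 144 ^ 2 * (e - (100 - θ) / 144)⁻¹ := by
  have g₁ := sub_ne_zero.2 h₁
  have g₂ := sub_ne_zero.2 h₂
  have g₃ := sub_ne_zero.2 h₃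
  rw [← sub_eq_zero]
  have key : ∀ p q r : ℝ, (e - 108 / 144) * p = 1 → (e - (104 + 4 * θ) / 144) * q = 1 →
      (e - (100 - θ) / 144) * r = 1 →
      (e - 108 / 144) * (e - (104 + 4 * θ) / 144) * (e - (100 - θ) / 144) *
      (e - (12 * (4 - θ) / 144 + 6 * (2 + θ) * (6 * (4 - θ)) / 144 ^ 2 * p
      + 2 * (8 + θ) * (4 * (8 + θ)) / 144 ^ 2 * q
      + (20 + 7 * θ) * (2 * (20 + 7 * θ)) / 144 ^ 2 * r)) = 0 := by
    intro p q r hp hq hr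
    unfold ssQuartic at h
    linear_combination (1 / 144 ^ 3) * h
      - (e - (104 + 4 * θ) / 144) * (e - (100 - θ) / 144)
        * (6 * (2 + θ) * (6 * (4 - θ)) / 144 ^ 2) * hp
      - (e - 108 / 144) * (e - (100 - θ) / 144) * (2 * (8 + θ) * (4 * (8 + θ)) / 144 ^ 2) * hq
      - (e - 108 / 144) * (e - (104 + 4 * θ) / 144)
        * ((20 + 7 * θ) * (2 * (20 + 7 * θ)) / 144 ^ 2) * hr
  exact (mul_eq_zero.1 (key _ _ _ (mul_inv_cancel₀ g₁) (mul_inv_cancel₀ g₂)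
    (mul_inv_cancel₀ g₃))).resolve_left (mul_ne_zero (mul_ne_zero g₁ g₂) g₃)

theorem ssP_mulVec_ssRight (h : ssQuartic θ e = 0) (h₁ : e ≠ 108 / 144)
    (h₂ : e ≠ (104 + 4 * θ) / 144) (h₃ : e ≠ (100 - θ) / 144) :
    ssP θ *ᵥ ssRight θ e = e • ssRight θ e := by
  have hs := ssQuartic_secular h h₁ h₂ h₃
  have hp := mul_inv_cancel₀ (sub_ne_zero.2 h₁)
  have hq := mul_inv_cancel₀ (sub_ne_zero.2 h₂)
  have hr := mul_inv_cancel₀ (sub_ne_zero.2 h₃)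
  unfold ssRight
  generalize (e - 108 / 144)⁻¹ = p at *
  generalize (e - (104 + 4 * θ) / 144)⁻¹ = q at *
  generalize (e - (100 - θ) / 144)⁻¹ = r at *
  ext i
  fin_cases i <;> simp [ssP, Matrix.mulVec, dotProduct, Fin.sum_univ_five]
  · linear_combination -hs
  · linear_combination -(6 * (2 + θ) / 144) * hp
  · linear_combination -(2 * (8 + θ) / 144) * hq
  · linear_combination -((20 + 7 * θ) / 144) * hr

theorem ssLeftSum_mul (h : ssQuartic θ e = 0) (h₁ : e ≠ 108 / 144)
    (h₂ : e ≠ (104 + 4 * θ) / 144) (h₃ : e ≠ (100 - θ) / 144) :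
    ssLeftSum θ e * ((120 + 6 * θ) / 144 - e) = -(6 * (4 - θ) / 144) := by
  have hs := ssQuartic_secular h h₁ h₂ h₃
  have hp := mul_inv_cancel₀ (sub_ne_zero.2 h₁)
  have hq := mul_inv_cancel₀ (sub_ne_zero.2 h₂)
  have hr := mul_inv_cancel₀ (sub_ne_zero.2 h₃)
  unfold ssLeftSum
  linear_combination -hs - (6 * (4 - θ) / 144) * hp - (4 * (8 + θ) / 144) * hq
    - (2 * (20 + 7 * θ) / 144) * hr

theorem ssLeft_vecMul_ssP (h : ssQuartic θ e = 0) (h₁ : e ≠ 108 / 144)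
    (h₂ : e ≠ (104 + 4 * θ) / 144) (h₃ : e ≠ (100 - θ) / 144) :
    ssLeft θ e ᵥ* ssP θ = e • ssLeft θ e := by
  have hs := ssQuartic_secular h h₁ h₂ h₃
  have hp := mul_inv_cancel₀ (sub_ne_zero.2 h₁)
  have hq := mul_inv_cancel₀ (sub_ne_zero.2 h₂)
  have hr := mul_inv_cancel₀ (sub_ne_zero.2 h₃)
  have hy := ssLeftSum_mul h h₁ h₂ h₃
  have hd : ssLeftSum θ e = _ := rfl
  unfold ssLeft
  conv_rhs at hd => unfold ssLeftSum
  generalize ssLeftSum θ e = y at *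
  generalize (e - 108 / 144)⁻¹ = p at *
  generalize (e - (104 + 4 * θ) / 144)⁻¹ = q at *
  generalize (e - (100 - θ) / 144)⁻¹ = r at *
  ext i
  fin_cases i <;> simp [ssP, Matrix.vecMul, dotProduct, Fin.sum_univ_five]
  · linear_combination -hs
  · linear_combination -(6 * (4 - θ) / 144) * hp
  · linear_combination -(4 * (8 + θ) / 144) * hq
  · linear_combination -(2 * (20 + 7 * θ) / 144) * hr
  · linear_combination -hy - (6 * (4 - θ) / 144) * hd

theorem ssLeft_dotProduct_ssRight_pos (hθ : θ ∈ Set.Ico (0 : ℝ) 1) :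
    0 < ssLeft θ e ⬝ᵥ ssRight θ e := by
  obtain ⟨h0, h1⟩ := hθ
  have h4 : 0 ≤ 4 - θ := by linarith
  have : ssLeft θ e ⬝ᵥ ssRight θ e =
      1 + 6 * (4 - θ) / 144 * (6 * (2 + θ) / 144) * ((e - 108 / 144)⁻¹) ^ 2
      + 4 * (8 + θ) / 144 * (2 * (8 + θ) / 144) * ((e - (104 + 4 * θ) / 144)⁻¹) ^ 2
      + 2 * (20 + 7 * θ) / 144 * ((20 + 7 * θ) / 144) * ((e - (100 - θ) / 144)⁻¹) ^ 2 := by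
    unfold ssLeft ssRight
    generalize (e - 108 / 144)⁻¹ = p
    generalize (e - (104 + 4 * θ) / 144)⁻¹ = q
    generalize (e - (100 - θ) / 144)⁻¹ = r
    simp [dotProduct, Fin.sum_univ_five]
    ring
  rw [this]
  positivity

end Root

theorem ssP_mulVec_one (θ : ℝ) : ssP θ *ᵥ 1 = (1 : ℝ) • 1 := by
  ext i
  fin_cases i <;> simp [ssP, Matrix.mulVec, dotProduct, Fin.sum_univ_five] <;> ring

theorem ssLeft_dotProduct_one (θ e : ℝ) : ssLeft θ e ⬝ᵥ 1 = 0 := by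
  simp [ssLeft, ssLeftSum, dotProduct, Fin.sum_univ_five]

/-- Sign changes of the quartic locate its four roots. -/
theorem exists_ssQuartic_roots {θ : ℝ} (hθ : θ ∈ Set.Ico (0 : ℝ) 1) :
    ∃ e₁ e₂ e₃ e₄ : ℝ,
      ssQuartic θ e₁ = 0 ∧ ssQuartic θ e₂ = 0 ∧ ssQuartic θ e₃ = 0 ∧ ssQuartic θ e₄ = 0 ∧
      e₁ ∈ Set.Ioo (108 / 144) 1 ∧ e₂ ∈ Set.Ioo ((104 + 4 * θ) / 144) (108 / 144) ∧
      e₃ ∈ Set.Ioo ((100 - θ) / 144) ((104 + 4 * θ) / 144) ∧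
      e₄ ∈ Set.Ioo 0 ((100 - θ) / 144) := by
  obtain ⟨h0, h1⟩ := hθ
  have hcont : Continuous (ssQuartic θ) := by unfold ssQuartic; fun_prop
  have s1 : 0 < ssQuartic θ 1 := by
    unfold ssQuartic
    nlinarith [mul_nonneg h0 h0, pow_nonneg h0 3, pow_nonneg h0 4, pow_le_one₀ (n := 2) h0 h1.le,
      pow_le_one₀ (n := 3) h0 h1.le, pow_le_one₀ (n := 4) h0 h1.le]
  have s2 : ssQuartic θ (108 / 144) < 0 := by
    have : ssQuartic θ (108 / 144) =
        -(1 / 144) * ((6 * (2 + θ)) * (6 * (4 - θ)) * (4 - 4 * θ) * (8 + θ)) := by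
      unfold ssQuartic; ring
    rw [this]
    have : 0 < (6 * (2 + θ)) * (6 * (4 - θ)) * (4 - 4 * θ) * (8 + θ) := by
      apply_rules [mul_pos] <;> linarith
    linarith
  have s3 : 0 < ssQuartic θ ((104 + 4 * θ) / 144) := by
    have : ssQuartic θ ((104 + 4 * θ) / 144) =
        (1 / 144) * ((2 * (8 + θ)) * (4 * (8 + θ)) * (4 - 4 * θ) * (4 + 5 * θ)) := by
      unfold ssQuartic; ring
    rw [this]
    have : 0 < (2 * (8 + θ)) * (4 * (8 + θ)) * (4 - 4 * θ) * (4 + 5 * θ) := by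
      apply_rules [mul_pos] <;> linarith
    linarith
  have s4 : ssQuartic θ ((100 - θ) / 144) < 0 := by
    have : ssQuartic θ ((100 - θ) / 144) =
        -(1 / 144) * ((20 + 7 * θ) * (2 * (20 + 7 * θ)) * (8 + θ) * (4 + 5 * θ)) := by
      unfold ssQuartic; ring
    rw [this]
    have : 0 < (20 + 7 * θ) * (2 * (20 + 7 * θ)) * (8 + θ) * (4 + 5 * θ) := by
      apply_rules [mul_pos] <;> linarith
    linarith
  have s5 : 0 < ssQuartic θ 0 := by
    unfold ssQuartic
    nlinarith [pow_le_one₀ (n := 2) h0 h1.le,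
      pow_le_one₀ (n := 3) h0 h1.le, pow_le_one₀ (n := 4) h0 h1.le]
  obtain ⟨e₁, m₁, r₁⟩ := intermediate_value_Ioo (by norm_num) hcont.continuousOn
    (⟨s2, s1⟩ : (0 : ℝ) ∈ Set.Ioo _ _)
  obtain ⟨e₂, m₂, r₂⟩ := intermediate_value_Ioo' (by linarith) hcont.continuousOn
    (⟨s2, s3⟩ : (0 : ℝ) ∈ Set.Ioo _ _)
  obtain ⟨e₃, m₃, r₃⟩ := intermediate_value_Ioo (by linarith) hcont.continuousOn
    (⟨s4, s3⟩ : (0 : ℝ) ∈ Set.Ioo _ _)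
  obtain ⟨e₄, m₄, r₄⟩ := intermediate_value_Ioo' (by linarith) hcont.continuousOn
    (⟨s4, s5⟩ : (0 : ℝ) ∈ Set.Ioo _ _)
  exact ⟨e₁, e₂, e₃, e₄, r₁, r₂, r₃, r₄, m₁, m₂, m₃, m₄⟩

/-- Under the Smith–Scott model with `θ ∈ [0,1)`, the quartic factor of the
characteristic polynomial has four distinct real roots interlacing the diagonal
entries, and the hand-length distribution is a linear combination of four geometric
distributions determined by these roots. -/
theorem smith_scott_hand_length_distribution (θ : ℝ) (hθ : θ ∈ Set.Ico (0 : ℝ) 1) :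
    ∃ e₁ e₂ e₃ e₄ : ℝ,
      ssQuartic θ e₁ = 0 ∧ ssQuartic θ e₂ = 0 ∧ ssQuartic θ e₃ = 0 ∧
      ssQuartic θ e₄ = 0 ∧
      1 > e₁ ∧ e₁ > 108 / 144 ∧ 108 / 144 > e₂ ∧ e₂ > (104 + 4 * θ) / 144 ∧
      (104 + 4 * θ) / 144 > e₃ ∧ e₃ > (100 - θ) / 144 ∧ (100 - θ) / 144 > e₄ ∧
      e₄ > 0 ∧
      ∃ c₁ c₂ c₃ c₄ : ℝ,
        c₁ > 0 ∧ c₂ < 0 ∧ c₃ < 0 ∧ c₄ < 0 ∧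
        c₁ + c₂ + c₃ + c₄ = 1 ∧
        c₁ * e₁ + c₂ * e₂ + c₃ * e₃ + c₄ * e₄ = 1 ∧
        (∀ m : ℕ, 1 ≤ m →
          (ssP θ ^ m) 0 4 =
            1 - (c₁ * e₁ ^ m + c₂ * e₂ ^ m + c₃ * e₃ ^ m + c₄ * e₄ ^ m)) ∧
        (∀ x : ℕ, 2 ≤ x →
          (ssP θ ^ x) 0 4 - (ssP θ ^ (x - 1)) 0 4 =
            c₁ * e₁ ^ (x - 1) * (1 - e₁) + c₂ * e₂ ^ (x - 1) * (1 - e₂)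
              + c₃ * e₃ ^ (x - 1) * (1 - e₃) + c₄ * e₄ ^ (x - 1) * (1 - e₄)) := by
  obtain ⟨e₁, e₂, e₃, e₄, r₁, r₂, r₃, r₄, ⟨a₁, b₁⟩, ⟨a₂, b₂⟩, ⟨a₃, b₃⟩, ⟨a₄, b₄⟩⟩ :=
    exists_ssQuartic_roots hθ
  refine ⟨e₁, e₂, e₃, e₄, r₁, r₂, r₃, r₄, b₁, a₁, b₂, a₂, b₃, a₃, b₄, a₄, ?_⟩
  have h0 := hθ.1
  have h1 := hθ.2
  have hne : ∀ e ∈ ({e₁, e₂, e₃, e₄} : Set ℝ), ssQuartic θ e = 0 ∧ e ≠ 108 / 144 ∧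
      e ≠ (104 + 4 * θ) / 144 ∧ e ≠ (100 - θ) / 144 := by
    rintro e (rfl | rfl | rfl | rfl)
    all_goals
      refine ⟨by assumption, ?_, ?_, ?_⟩ <;> intro h <;> linarith
  have hR : ∀ e ∈ ({e₁, e₂, e₃, e₄} : Set ℝ), ssP θ *ᵥ ssRight θ e = e • ssRight θ e :=
    fun e he => let ⟨h, h₁, h₂, h₃⟩ := hne e he; ssP_mulVec_ssRight h h₁ h₂ h₃
  have hR0 : ∀ e, ssRight θ e ≠ 0 := fun e h => by simpa [ssRight] using congrFun h 0
  have hinj : Function.Injective ![e₁, e₂, e₃, e₄, 1] := by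
    have : StrictAnti ![1, e₁, e₂, e₃, e₄] := by
      rw [Fin.strictAnti_iff_succ_lt]
      intro i
      fin_cases i <;> simp <;> linarith
    have hcomp : ![e₁, e₂, e₃, e₄, 1] = ![1, e₁, e₂, e₃, e₄] ∘ finRotate 5 := by
      ext i
      fin_cases i <;> rfl
    rw [hcomp]
    exact this.injective.comp (finRotate 5).injective
  obtain ⟨c, hc⟩ := Matrix.exists_pow_mulVec_eq_sum_of_injective_eigenvalues
    (A := ssP θ) (v := ![ssRight θ e₁, ssRight θ e₂, ssRight θ e₃, ssRight θ e₄, 1]) hinj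
    (by
      intro i
      fin_cases i
      · exact hR e₁ (by simp)
      · exact hR e₂ (by simp)
      · exact hR e₃ (by simp)
      · exact hR e₄ (by simp)
      · exact ssP_mulVec_one θ)
    (by
      intro i
      fin_cases i
      exacts [hR0 _, hR0 _, hR0 _, hR0 _, one_ne_zero])
    (Pi.single 4 1)
  have hx : (Pi.single 4 1 : Fin 5 → ℝ) = c 0 • ssRight θ e₁ + c 1 • ssRight θ e₂
      + c 2 • ssRight θ e₃ + c 3 • ssRight θ e₄ + c 4 • 1 := by
    have h := hc 0
    rw [pow_zero, Matrix.one_mulVec] at h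
    simpa [Fin.sum_univ_five] using h
  have hc4 : c 4 = 1 := by
    simpa [ssRight, eq_comm] using congrFun hx 4
  have hpow : ∀ m : ℕ, (ssP θ ^ m) 0 4 =
      1 - (-c 0 * e₁ ^ m + -c 1 * e₂ ^ m + -c 2 * e₃ ^ m + -c 3 * e₄ ^ m) := by
    intro m
    have h := congrFun (hc m) 0
    simp [Fin.sum_univ_five, ssRight, hc4] at h
    rw [h]
    ring
  have horth : ∀ e ∈ ({e₁, e₂, e₃, e₄} : Set ℝ), ∀ f ∈ ({e₁, e₂, e₃, e₄} : Set ℝ), e ≠ f →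
      ssLeft θ e ⬝ᵥ ssRight θ f = 0 := by
    intro e he f hf hef
    obtain ⟨h, h₁, h₂, h₃⟩ := hne e he
    exact Matrix.dotProduct_eq_zero_of_eigenvalue_ne (ssLeft_vecMul_ssP h h₁ h₂ h₃) (hR f hf) hef
  have hlast : ∀ e, ssLeft θ e ⬝ᵥ Pi.single 4 1 = -ssLeftSum θ e := fun e => by simp [ssLeft]
  have hsign : ∀ e ∈ ({e₁, e₂, e₃, e₄} : Set ℝ), e < 108 / 144 → ∀ k : ℝ,
      -ssLeftSum θ e = k * (ssLeft θ e ⬝ᵥ ssRight θ e) → -k < 0 := by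
    intro e he hlt k hk
    obtain ⟨h, h₁, h₂, h₃⟩ := hne e he
    have hmul := ssLeftSum_mul h h₁ h₂ h₃
    have hpos : 0 < (120 + 6 * θ) / 144 - e := by linarith
    have hs : 0 < -ssLeftSum θ e := by
      refine pos_of_mul_pos_left (b := (120 + 6 * θ) / 144 - e) ?_ hpos.le
      linarith
    rw [hk] at hs
    exact neg_lt_zero.2 (pos_of_mul_pos_left hs (ssLeft_dotProduct_ssRight_pos hθ).le)
  have hexp : ∀ e, -ssLeftSum θ e = c 0 * (ssLeft θ e ⬝ᵥ ssRight θ e₁)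
      + c 1 * (ssLeft θ e ⬝ᵥ ssRight θ e₂) + c 2 * (ssLeft θ e ⬝ᵥ ssRight θ e₃)
      + c 3 * (ssLeft θ e ⬝ᵥ ssRight θ e₄) := by
    intro e
    rw [← hlast, hx]
    simp only [dotProduct_add, dotProduct_smul, ssLeft_dotProduct_one, smul_eq_mul]
    ring
  have n₂ : -c 1 < 0 := hsign e₂ (by simp) b₂ _ (by
    rw [hexp, horth e₂ (by simp) e₁ (by simp) (by intro h; linarith),
      horth e₂ (by simp) e₃ (by simp) (by intro h; linarith),
      horth e₂ (by simp) e₄ (by simp) (by intro h; linarith)]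
    ring)
  have n₃ : -c 2 < 0 := hsign e₃ (by simp) (by linarith) _ (by
    rw [hexp, horth e₃ (by simp) e₁ (by simp) (by intro h; linarith),
      horth e₃ (by simp) e₂ (by simp) (by intro h; linarith),
      horth e₃ (by simp) e₄ (by simp) (by intro h; linarith)]
    ring)
  have n₄ : -c 3 < 0 := hsign e₄ (by simp) (by linarith) _ (by
    rw [hexp, horth e₄ (by simp) e₁ (by simp) (by intro h; linarith),
      horth e₄ (by simp) e₂ (by simp) (by intro h; linarith),
      horth e₄ (by simp) e₃ (by simp) (by intro h; linarith)]
    ring)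
  have hsum : -c 0 + -c 1 + -c 2 + -c 3 = 1 := by
    have h := hpow 0
    simp at h
    linarith
  refine ⟨-c 0, -c 1, -c 2, -c 3, by linarith, n₂, n₃, n₄, hsum, ?_, fun m _ => hpow m, ?_⟩
  · have h := hpow 1
    simp [ssP] at h
    linarith
  · intro x hx2
    obtain ⟨y, rfl⟩ : ∃ y, x = y + 1 := ⟨x - 1, by omega⟩
    rw [hpow, hpow, Nat.add_sub_cancel]
    ring
end

section
/- Under the Wong–Shackleford model, for every θ ∈ [0,1): the quartic polynomial 209952 z⁴ − 34992(15+2θ) z³ + 162(2863 + 786θ + 55θ²) z² − 9(18321 + 7926θ + 1163θ² + 58θ³) z + (17775 + 11457θ + 2768θ² + 298θ³ + 12θ⁴) has four distinct real roots e₁ > e₂ > e₃ > e₄ satisfying 1 > e₁ > (27+3θ)/36 > e₂ > (26+4θ)/36 > e₃ > (25+3θ)/36 > e₄ > 0, and there exist real numbers c₁ > 0, c₂ < 0, c₃ < 0, c₄ < 0 such that c₁ + c₂ + c₃ + c₄ = 1, c₁e₁ + c₂e₂ + c₃e₃ + c₄e₄ = 1, and for every integer m ≥ 1, (P_θ^m)_{co,7o}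 = 1 − (c₁e₁^m + c₂e₂^m + c₃e₃^m + c₄e₄^m); equivalently, the distribution of the hand length L is a linear combination of four geometric distributions: P_θ(L = x) = Σᵢ cᵢ·eᵢ^{x−1}(1−eᵢ) for every integer x ≥ 2. -/
/-- The quartic factor of the characteristic polynomial of `wsP θ`. -/
def wsQuartic (θ z : ℝ) : ℝ :=
  209952 * z ^ 4 - 34992 * (15 + 2 * θ) * z ^ 3
    + 162 * (2863 + 786 * θ + 55 * θ ^ 2) * z ^ 2
    - 9 * (18321 + 7926 * θ + 1163 * θ ^ 2 + 58 * θ ^ 3) * z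
    + (17775 + 11457 * θ + 2768 * θ ^ 2 + 298 * θ ^ 3 + 12 * θ ^ 4)

/-- The coefficient of `e₁` in the partial fraction expansion of `q / ∏ (x - eᵢ)`. -/
noncomputable def residue (q : ℝ → ℝ) (e₁ e₂ e₃ e₄ : ℝ) : ℝ :=
  q e₁ / ((e₁ - e₂) * (e₁ - e₃) * (e₁ - e₄))

theorem sum_residue_of_cubic {q : ℝ → ℝ} {a b c d : ℝ}
    (hq : ∀ x, q x = a * x ^ 3 + b * x ^ 2 + c * x + d) {e₁ e₂ e₃ e₄ : ℝ}
    (h₁₂ : e₂ < e₁) (h₂₃ : e₃ < e₂) (h₃₄ : e₄ < e₃) :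
    residue q e₁ e₂ e₃ e₄ + residue q e₂ e₁ e₃ e₄ + residue q e₃ e₁ e₂ e₄
      + residue q e₄ e₁ e₂ e₃ = a := by
  have h1 : e₁ - e₂ ≠ 0 := by linarith
  have h2 : e₁ - e₃ ≠ 0 := by linarith
  have h3 : e₁ - e₄ ≠ 0 := by linarith
  have h4 : e₂ - e₃ ≠ 0 := by linarith
  have h5 : e₂ - e₄ ≠ 0 := by linarith
  have h6 : e₃ - e₄ ≠ 0 := by linarith
  simp only [residue, hq]
  rw [← neg_sub e₁ e₂, ← neg_sub e₁ e₃, ← neg_sub e₁ e₄, ← neg_sub e₂ e₃, ← neg_sub e₂ e₄,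
    ← neg_sub e₃ e₄]
  field_simp
  ring

theorem cubic_eq_interpolation {q : ℝ → ℝ} {a b c d : ℝ}
    (hq : ∀ x, q x = a * x ^ 3 + b * x ^ 2 + c * x + d) {e₁ e₂ e₃ e₄ : ℝ}
    (h₁₂ : e₂ < e₁) (h₂₃ : e₃ < e₂) (h₃₄ : e₄ < e₃) (x : ℝ) :
    q x = residue q e₁ e₂ e₃ e₄ * ((x - e₂) * (x - e₃) * (x - e₄))
      + residue q e₂ e₁ e₃ e₄ * ((x - e₁) * (x - e₃) * (x - e₄))
      + residue q e₃ e₁ e₂ e₄ * ((x - e₁) * (x - e₂) * (x - e₄))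
      + residue q e₄ e₁ e₂ e₃ * ((x - e₁) * (x - e₂) * (x - e₃)) := by
  have h1 : e₁ - e₂ ≠ 0 := by linarith
  have h2 : e₁ - e₃ ≠ 0 := by linarith
  have h3 : e₁ - e₄ ≠ 0 := by linarith
  have h4 : e₂ - e₃ ≠ 0 := by linarith
  have h5 : e₂ - e₄ ≠ 0 := by linarith
  have h6 : e₃ - e₄ ≠ 0 := by linarith
  simp only [residue, hq]
  rw [← neg_sub e₁ e₂, ← neg_sub e₁ e₃, ← neg_sub e₁ e₄, ← neg_sub e₂ e₃, ← neg_sub e₂ e₄,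
    ← neg_sub e₃ e₄]
  field_simp
  ring

theorem sum_residue_div_of_cubic {q : ℝ → ℝ} {a b c d : ℝ}
    (hq : ∀ x, q x = a * x ^ 3 + b * x ^ 2 + c * x + d) {e₁ e₂ e₃ e₄ : ℝ}
    (h₁₂ : e₂ < e₁) (h₂₃ : e₃ < e₂) (h₃₄ : e₄ < e₃) {x : ℝ}
    (hx : (x - e₁) * (x - e₂) * (x - e₃) * (x - e₄) ≠ 0) :
    residue q e₁ e₂ e₃ e₄ / (e₁ - x) + residue q e₂ e₁ e₃ e₄ / (e₂ - x)
      + residue q e₃ e₁ e₂ e₄ / (e₃ - x) + residue q e₄ e₁ e₂ e₃ / (e₄ - x)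
      = -q x / ((x - e₁) * (x - e₂) * (x - e₃) * (x - e₄)) := by
  obtain ⟨⟨⟨h1, h2⟩, h3⟩, h4⟩ := by simpa only [mul_ne_zero_iff] using hx
  rw [cubic_eq_interpolation hq h₁₂ h₂₃ h₃₄ x, ← neg_sub x e₁, ← neg_sub x e₂, ← neg_sub x e₃,
    ← neg_sub x e₄]
  field_simp
  ring

theorem wsQuartic_eq_of_roots {θ e₁ e₂ e₃ e₄ : ℝ}
    (h₁₂ : e₂ < e₁) (h₂₃ : e₃ < e₂) (h₃₄ : e₄ < e₃)
    (h₁ : wsQuartic θ e₁ = 0) (h₂ : wsQuartic θ e₂ = 0) (h₃ : wsQuartic θ e₃ = 0)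
    (h₄ : wsQuartic θ e₄ = 0) (x : ℝ) :
    wsQuartic θ x = 209952 * ((x - e₁) * (x - e₂) * (x - e₃) * (x - e₄)) := by
  let q : ℝ → ℝ := fun x =>
    wsQuartic θ x - 209952 * ((x - e₁) * (x - e₂) * (x - e₃) * (x - e₄))
  have hq : ∀ x, q x = (209952 * (e₁ + e₂ + e₃ + e₄) - 34992 * (15 + 2 * θ)) * x ^ 3
      + (162 * (2863 + 786 * θ + 55 * θ ^ 2)
        - 209952 * (e₁ * e₂ + e₁ * e₃ + e₁ * e₄ + e₂ * e₃ + e₂ * e₄ + e₃ * e₄)) * x ^ 2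
      + (209952 * (e₁ * e₂ * e₃ + e₁ * e₂ * e₄ + e₁ * e₃ * e₄ + e₂ * e₃ * e₄)
        - 9 * (18321 + 7926 * θ + 1163 * θ ^ 2 + 58 * θ ^ 3)) * x
      + (17775 + 11457 * θ + 2768 * θ ^ 2 + 298 * θ ^ 3 + 12 * θ ^ 4
        - 209952 * (e₁ * e₂ * e₃ * e₄)) := by
    intro x
    simp only [q, wsQuartic]
    ring
  have h := cubic_eq_interpolation hq h₁₂ h₂₃ h₃₄ x
  simp only [residue, q, h₁, h₂, h₃, h₄, sub_self, mul_zero, zero_mul, zero_div, add_zero] at h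
  linear_combination h

theorem exists_root_of_sign_change {f : ℝ → ℝ} (hf : Continuous f) {a b : ℝ} (hab : a < b)
    (h : f a * f b < 0) : ∃ x, f x = 0 ∧ a < x ∧ x < b := by
  rcases mul_neg_iff.1 h with ⟨ha, hb⟩ | ⟨ha, hb⟩
  · obtain ⟨x, hx, h0⟩ := intermediate_value_Ioo' hab.le hf.continuousOn ⟨hb, ha⟩
    exact ⟨x, h0, hx.1, hx.2⟩
  · obtain ⟨x, hx, h0⟩ := intermediate_value_Ioo hab.le hf.continuousOn ⟨ha, hb⟩
    exact ⟨x, h0, hx.1, hx.2⟩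

/-- The roots of the quartic interlace the diagonal entries of `wsP θ`, and the largest one
exceeds the probability `(30 + 4 * θ) / 36` that the hand does not end on a roll with a point. -/
theorem exists_roots_wsQuartic {θ : ℝ} (h0 : 0 ≤ θ) (h1 : θ < 1) :
    ∃ e₁ e₂ e₃ e₄ : ℝ, wsQuartic θ e₁ = 0 ∧ wsQuartic θ e₂ = 0 ∧ wsQuartic θ e₃ = 0 ∧
      wsQuartic θ e₄ = 0 ∧ e₁ < 1 ∧ (30 + 4 * θ) / 36 < e₁ ∧ e₂ < (27 + 3 * θ) / 36 ∧
      (26 + 4 * θ) / 36 < e₂ ∧ e₃ < (26 + 4 * θ) / 36 ∧ (25 + 3 * θ) / 36 < e₃ ∧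
      e₄ < (25 + 3 * θ) / 36 ∧ 0 < e₄ := by
  have hc : Continuous (wsQuartic θ) := by
    unfold wsQuartic
    fun_prop
  have p0 : 0 < wsQuartic θ 0 := by
    simp only [wsQuartic]
    ring_nf
    positivity
  have pd : wsQuartic θ ((25 + 3 * θ) / 36) < 0 := by
    have : wsQuartic θ ((25 + 3 * θ) / 36) = -(5 / 2 * (5 + θ) * (1 + θ)) := by
      simp only [wsQuartic]
      ring
    rw [this, neg_lt_zero]
    positivity
  have pb : 0 < wsQuartic θ ((26 + 4 * θ) / 36) := by
    have : wsQuartic θ ((26 + 4 * θ) / 36) = 4 * (1 - θ) * (1 + θ) := by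
      simp only [wsQuartic]
      ring
    rw [this]
    have : 0 < 1 - θ := by linarith
    positivity
  have pa : wsQuartic θ ((27 + 3 * θ) / 36) < 0 := by
    have : wsQuartic θ ((27 + 3 * θ) / 36) = -(1 / 2 * (3 - θ) * (3 + θ) * (1 - θ)) := by
      simp only [wsQuartic]
      ring
    rw [this, neg_lt_zero]
    have : 0 < 1 - θ := by linarith
    have : 0 < 3 - θ := by linarith
    positivity
  have pk : wsQuartic θ ((30 + 4 * θ) / 36) < 0 := by
    have : wsQuartic θ ((30 + 4 * θ) / 36) = -((3 + θ) * (5 + θ) * (3 - 2 * θ)) := by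
      simp only [wsQuartic]
      ring
    rw [this, neg_lt_zero]
    have : 0 < 3 - 2 * θ := by linarith
    positivity
  have p1 : 0 < wsQuartic θ 1 := by
    simp only [wsQuartic]
    nlinarith [mul_nonneg h0 h0, mul_nonneg h0 (mul_nonneg h0 h0), pow_nonneg h0 4]
  obtain ⟨e₁, r₁, l₁, u₁⟩ := exists_root_of_sign_change hc (by linarith)
    (mul_neg_of_neg_of_pos pk p1)
  obtain ⟨e₂, r₂, l₂, u₂⟩ := exists_root_of_sign_change hc (by linarith)
    (mul_neg_of_pos_of_neg pb pa)
  obtain ⟨e₃, r₃, l₃, u₃⟩ := exists_root_of_sign_change hc (by linarith)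
    (mul_neg_of_neg_of_pos pd pb)
  obtain ⟨e₄, r₄, l₄, u₄⟩ := exists_root_of_sign_change hc (by linarith)
    (mul_neg_of_pos_of_neg p0 pd)
  exact ⟨e₁, e₂, e₃, e₄, r₁, r₂, r₃, r₄, u₁, l₁, u₂, l₂, u₃, l₃, u₄, l₄⟩

/-- The numerator of the `co` entry of the generating function `∑ P(L > m) / z ^ (m + 1)`,
whose denominator is the monic multiple of `wsQuartic θ`. -/
noncomputable def wsNumerator (θ z : ℝ) : ℝ :=
  (z - (27 + 3 * θ) / 36) * (z - (26 + 4 * θ) / 36) * (z - (25 + 3 * θ) / 36)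
    + 2 * (3 - θ) / 36 * ((z - (26 + 4 * θ) / 36) * (z - (25 + 3 * θ) / 36))
    + 8 / 36 * ((z - (27 + 3 * θ) / 36) * (z - (25 + 3 * θ) / 36))
    + 10 / 36 * ((z - (27 + 3 * θ) / 36) * (z - (26 + 4 * θ) / 36))

theorem wsNumerator_mul_sub (θ z : ℝ) :
    wsNumerator θ z * (z - (30 + 4 * θ) / 36) = wsQuartic θ z / 209952
      + 2 * (3 - 2 * θ) / 36
        * ((z - (27 + 3 * θ) / 36) * (z - (26 + 4 * θ) / 36) * (z - (25 + 3 * θ) / 36)) := by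
  simp only [wsNumerator, wsQuartic]
  ring

theorem wsNumerator_eq_cubic (θ z : ℝ) :
    wsNumerator θ z = 1 * z ^ 3 + (-(78 + 10 * θ) / 36 + (24 - 2 * θ) / 36) * z ^ 2
      + (wsNumerator θ 1 - wsNumerator θ 0 - 1
        - (-(78 + 10 * θ) / 36 + (24 - 2 * θ) / 36)) * z + wsNumerator θ 0 := by
  simp only [wsNumerator]
  ring

/-- The right eigenvector of `wsP θ` for the eigenvalue `e`, a root of `wsQuartic θ`. -/
noncomputable def wsEigenvector (θ e : ℝ) : Fin 5 → ℝ :=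
  ![1, (3 + θ) / 36 / (e - (27 + 3 * θ) / 36), 4 / 36 / (e - (26 + 4 * θ) / 36),
    (5 + θ) / 36 / (e - (25 + 3 * θ) / 36), 0]

open Matrix in
theorem wsP_mulVec_wsEigenvector {θ e : ℝ} (h : wsQuartic θ e = 0)
    (ha : e ≠ (27 + 3 * θ) / 36) (hb : e ≠ (26 + 4 * θ) / 36) (hd : e ≠ (25 + 3 * θ) / 36) :
    wsP θ *ᵥ wsEigenvector θ e = e • wsEigenvector θ e := by
  have ha' := sub_ne_zero.2 ha
  have hb' := sub_ne_zero.2 hb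
  have hd' := sub_ne_zero.2 hd
  ext i
  fin_cases i <;>
    simp [wsP, wsEigenvector, Matrix.mulVec, dotProduct, Fin.sum_univ_five]
  · generalize hA : e - (27 + 3 * θ) / 36 = A at *
    generalize hB : e - (26 + 4 * θ) / 36 = B at *
    generalize hD : e - (25 + 3 * θ) / 36 = D at *
    field_simp
    subst hA hB hD
    simp only [wsQuartic] at h
    linear_combination (-1 / 162 : ℝ) * h
  · linear_combination (-1 : ℝ) * div_mul_cancel₀ ((3 + θ) / 36) ha'
  · linear_combination (-1 : ℝ) * div_mul_cancel₀ (4 / 36) hb'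
  · linear_combination (-1 : ℝ) * div_mul_cancel₀ ((5 + θ) / 36) hd'

open Matrix in
theorem wsP_mulVec_one (θ : ℝ) : wsP θ *ᵥ (fun _ => 1) = fun _ => 1 := by
  ext i
  fin_cases i <;> simp [wsP, Matrix.mulVec, dotProduct, Fin.sum_univ_five] <;> ring

open Matrix in
theorem pow_mulVec_of_mulVec_eq_smul {ι R : Type*} [Fintype ι] [DecidableEq ι] [CommRing R]
    {A : Matrix ι ι R} {v : ι → R} {e : R} (h : A *ᵥ v = e • v) (m : ℕ) :
    A ^ m *ᵥ v = e ^ m • v := by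
  induction m with
  | zero => simp
  | succ m ih => rw [pow_succ, ← Matrix.mulVec_mulVec, h, Matrix.mulVec_smul, ih, smul_smul,
      pow_succ']

/-- Under the Wong–Shackleford model with `θ ∈ [0,1)`, the quartic factor of the
characteristic polynomial has four distinct real roots interlacing the diagonal
entries, and the hand-length distribution is a linear combination of four geometric
distributions determined by these roots. -/
theorem wong_shackleford_hand_length_distribution (θ : ℝ) (hθ : θ ∈ Set.Ico (0 : ℝ) 1) :
    ∃ e₁ e₂ e₃ e₄ : ℝ,
      wsQuartic θ e₁ = 0 ∧ wsQuartic θ e₂ = 0 ∧ wsQuartic θ e₃ = 0 ∧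
      wsQuartic θ e₄ = 0 ∧
      1 > e₁ ∧ e₁ > (27 + 3 * θ) / 36 ∧ (27 + 3 * θ) / 36 > e₂ ∧
      e₂ > (26 + 4 * θ) / 36 ∧ (26 + 4 * θ) / 36 > e₃ ∧ e₃ > (25 + 3 * θ) / 36 ∧
      (25 + 3 * θ) / 36 > e₄ ∧ e₄ > 0 ∧
      ∃ c₁ c₂ c₃ c₄ : ℝ,
        c₁ > 0 ∧ c₂ < 0 ∧ c₃ < 0 ∧ c₄ < 0 ∧
        c₁ + c₂ + c₃ + c₄ = 1 ∧
        c₁ * e₁ + c₂ * e₂ + c₃ * e₃ + c₄ * e₄ = 1 ∧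
        (∀ m : ℕ, 1 ≤ m →
          (wsP θ ^ m) 0 4 =
            1 - (c₁ * e₁ ^ m + c₂ * e₂ ^ m + c₃ * e₃ ^ m + c₄ * e₄ ^ m)) ∧
        (∀ x : ℕ, 2 ≤ x →
          (wsP θ ^ x) 0 4 - (wsP θ ^ (x - 1)) 0 4 =
            c₁ * e₁ ^ (x - 1) * (1 - e₁) + c₂ * e₂ ^ (x - 1) * (1 - e₂)
              + c₃ * e₃ ^ (x - 1) * (1 - e₃) + c₄ * e₄ ^ (x - 1) * (1 - e₄)) := by
  obtain ⟨h0, h1⟩ := hθ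
  obtain ⟨e₁, e₂, e₃, e₄, r₁, r₂, r₃, r₄, u₁, l₁, u₂, l₂, u₃, l₃, u₄, l₄⟩ :=
    exists_roots_wsQuartic h0 h1
  have h₁₂ : e₂ < e₁ := by linarith
  have h₂₃ : e₃ < e₂ := by linarith
  have h₃₄ : e₄ < e₃ := by linarith
  refine ⟨e₁, e₂, e₃, e₄, r₁, r₂, r₃, r₄, u₁, by linarith, u₂, l₂, u₃, l₃, u₄, l₄, ?_⟩
  have hN := wsNumerator_eq_cubic θ
  have hfac := wsQuartic_eq_of_roots h₁₂ h₂₃ h₃₄ r₁ r₂ r₃ r₄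
  have hh : 0 < 2 * (3 - 2 * θ) / 36 := by linarith
  have n₁ : 0 < wsNumerator θ e₁ := by
    refine pos_of_mul_pos_left (b := e₁ - (30 + 4 * θ) / 36) ?_ (by linarith)
    rw [wsNumerator_mul_sub, r₁, zero_div, zero_add]
    exact mul_pos hh (mul_pos (mul_pos (by linarith) (by linarith)) (by linarith))
  have n₂ : 0 < wsNumerator θ e₂ := by
    refine pos_of_mul_neg_left (b := e₂ - (30 + 4 * θ) / 36) ?_ (by linarith)
    rw [wsNumerator_mul_sub, r₂, zero_div, zero_add]
    exact mul_neg_of_pos_of_neg hh (mul_neg_of_neg_of_pos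
      (mul_neg_of_neg_of_pos (by linarith) (by linarith)) (by linarith))
  have n₃ : wsNumerator θ e₃ < 0 := by
    refine neg_of_mul_pos_left (b := e₃ - (30 + 4 * θ) / 36) ?_ (by linarith)
    rw [wsNumerator_mul_sub, r₃, zero_div, zero_add]
    exact mul_pos hh (mul_pos (mul_pos_of_neg_of_neg (by linarith) (by linarith)) (by linarith))
  have n₄ : 0 < wsNumerator θ e₄ := by
    refine pos_of_mul_neg_left (b := e₄ - (30 + 4 * θ) / 36) ?_ (by linarith)
    rw [wsNumerator_mul_sub, r₄, zero_div, zero_add]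
    exact mul_neg_of_pos_of_neg hh (mul_neg_of_pos_of_neg
      (mul_pos_of_neg_of_neg (by linarith) (by linarith)) (by linarith))
  have hc := sum_residue_of_cubic hN h₁₂ h₂₃ h₃₄
  have c₁_pos : 0 < residue (wsNumerator θ) e₁ e₂ e₃ e₄ :=
    div_pos n₁ (mul_pos (mul_pos (by linarith) (by linarith)) (by linarith))
  have c₂_neg : residue (wsNumerator θ) e₂ e₁ e₃ e₄ < 0 :=
    div_neg_of_pos_of_neg n₂ (mul_neg_of_neg_of_pos
      (mul_neg_of_neg_of_pos (by linarith) (by linarith)) (by linarith))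
  have c₃_neg : residue (wsNumerator θ) e₃ e₁ e₂ e₄ < 0 :=
    div_neg_of_neg_of_pos n₃ (mul_pos
      (mul_pos_of_neg_of_neg (by linarith) (by linarith)) (by linarith))
  have c₄_neg : residue (wsNumerator θ) e₄ e₁ e₂ e₃ < 0 :=
    div_neg_of_pos_of_neg n₄ (mul_neg_of_pos_of_neg
      (mul_pos_of_neg_of_neg (by linarith) (by linarith)) (by linarith))
  have hres : ∀ {x l : ℝ}, x ≠ e₁ → x ≠ e₂ → x ≠ e₃ → x ≠ e₄ →
      wsQuartic θ x / 209952 = -l * wsNumerator θ x →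
      residue (wsNumerator θ) e₁ e₂ e₃ e₄ * (l / (e₁ - x))
        + residue (wsNumerator θ) e₂ e₁ e₃ e₄ * (l / (e₂ - x))
        + residue (wsNumerator θ) e₃ e₁ e₂ e₄ * (l / (e₃ - x))
        + residue (wsNumerator θ) e₄ e₁ e₂ e₃ * (l / (e₄ - x)) = 1 := by
    intro x l x₁ x₂ x₃ x₄ hx
    have hx0 : (x - e₁) * (x - e₂) * (x - e₃) * (x - e₄) ≠ 0 :=
      mul_ne_zero (mul_ne_zero (mul_ne_zero (sub_ne_zero.2 x₁) (sub_ne_zero.2 x₂))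
        (sub_ne_zero.2 x₃)) (sub_ne_zero.2 x₄)
    have h := sum_residue_div_of_cubic hN h₁₂ h₂₃ h₃₄ hx0
    rw [hfac, mul_div_cancel_left₀ _ (by norm_num)] at hx
    have h' : l * (-wsNumerator θ x / ((x - e₁) * (x - e₂) * (x - e₃) * (x - e₄))) = 1 := by
      rw [← mul_div_assoc, div_eq_one_iff_eq hx0, hx]
      ring
    linear_combination l * h + h'
  have ha := hres (x := (27 + 3 * θ) / 36) (l := (3 + θ) / 36) (by linarith) (by linarith)
    (by linarith) (by linarith) (by simp only [wsQuartic, wsNumerator]; ring)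
  have hb := hres (x := (26 + 4 * θ) / 36) (l := 4 / 36) (by linarith) (by linarith)
    (by linarith) (by linarith) (by simp only [wsQuartic, wsNumerator]; ring)
  have hd := hres (x := (25 + 3 * θ) / 36) (l := (5 + θ) / 36) (by linarith) (by linarith)
    (by linarith) (by linarith) (by simp only [wsQuartic, wsNumerator]; ring)
  generalize residue (wsNumerator θ) e₁ e₂ e₃ e₄ = c₁ at *
  generalize residue (wsNumerator θ) e₂ e₁ e₃ e₄ = c₂ at *
  generalize residue (wsNumerator θ) e₃ e₁ e₂ e₄ = c₃ at *
  generalize residue (wsNumerator θ) e₄ e₁ e₂ e₃ = c₄ at *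
  have hdecomp : (Pi.single 4 1 : Fin 5 → ℝ) = (fun _ => 1) - (c₁ • wsEigenvector θ e₁
      + c₂ • wsEigenvector θ e₂ + c₃ • wsEigenvector θ e₃ + c₄ • wsEigenvector θ e₄) := by
    ext i
    fin_cases i <;> simp [wsEigenvector] <;> linarith
  have hpow : ∀ m : ℕ, (wsP θ ^ m) 0 4 =
      1 - (c₁ * e₁ ^ m + c₂ * e₂ ^ m + c₃ * e₃ ^ m + c₄ * e₄ ^ m) := by
    intro m
    have h := congrFun (Matrix.mulVec_single_one (wsP θ ^ m) 4) 0
    rw [Matrix.col_apply] at h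
    rw [← h, hdecomp, Matrix.mulVec_sub, Matrix.mulVec_add, Matrix.mulVec_add, Matrix.mulVec_add,
      Matrix.mulVec_smul, Matrix.mulVec_smul, Matrix.mulVec_smul, Matrix.mulVec_smul,
      pow_mulVec_of_mulVec_eq_smul (e := 1) (by rw [wsP_mulVec_one, one_smul]),
      pow_mulVec_of_mulVec_eq_smul (wsP_mulVec_wsEigenvector r₁ (by linarith) (by linarith)
        (by linarith)),
      pow_mulVec_of_mulVec_eq_smul (wsP_mulVec_wsEigenvector r₂ (by linarith) (by linarith)
        (by linarith)),
      pow_mulVec_of_mulVec_eq_smul (wsP_mulVec_wsEigenvector r₃ (by linarith) (by linarith)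
        (by linarith)),
      pow_mulVec_of_mulVec_eq_smul (wsP_mulVec_wsEigenvector r₄ (by linarith) (by linarith)
        (by linarith))]
    simp [wsEigenvector]
  refine ⟨c₁, c₂, c₃, c₄, c₁_pos, c₂_neg, c₃_neg, c₄_neg, hc, ?_, fun m _ => hpow m, ?_⟩
  · have h := hpow 1
    have hP : (wsP θ ^ 1) 0 4 = 0 := by simp [wsP]
    rw [hP] at h
    linarith
  · intro x hx
    obtain ⟨m, rfl⟩ : ∃ m, x = m + 1 := ⟨x - 1, by omega⟩
    rw [hpow, hpow, Nat.add_sub_cancel]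
    ring
end

section
/- Under the Smith–Scott model, for every integer m ≥ 1, the function θ ↦ (P_θ^m)_{co,7o} is nonincreasing on [0,1]; equivalently, for every integer x ≥ 2, the tail probability P_θ(L ≥ x) = 1 − (P_θ^{x−1})_{co,7o} of the hand length L is nondecreasing in θ on [0,1]. -/
/-- The probability that the chain started at `i` has not been absorbed after `n` steps. -/
noncomputable def ssTail (θ : ℝ) (n : ℕ) (i : Fin 5) : ℝ := 1 - (ssP θ ^ n) i 4

lemma ssP_pow_absorbing (θ : ℝ) (n : ℕ) : (ssP θ ^ n) 4 4 = 1 := by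
  induction n with
  | zero => simp
  | succ n ih =>
    rw [pow_succ', Matrix.mul_apply, Fin.sum_univ_five, ih]
    simp [ssP]

lemma ssTail_zero (θ : ℝ) {i : Fin 5} (hi : i ≠ 4) : ssTail θ 0 i = 1 := by
  simp [ssTail, Matrix.one_apply_ne hi]

lemma ssTail_succ_zero (θ : ℝ) (n : ℕ) :
    ssTail θ (n + 1) 0 = (12 * (4 - θ) * ssTail θ n 0 + 6 * (4 - θ) * ssTail θ n 1 +
      4 * (8 + θ) * ssTail θ n 2 + 2 * (20 + 7 * θ) * ssTail θ n 3) / 144 := by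
  simp only [ssTail]
  rw [pow_succ', Matrix.mul_apply, Fin.sum_univ_five]
  simp [ssP]
  ring

lemma ssTail_succ_one (θ : ℝ) (n : ℕ) :
    ssTail θ (n + 1) 1 = (6 * (2 + θ) * ssTail θ n 0 + 108 * ssTail θ n 1) / 144 := by
  simp only [ssTail]
  rw [pow_succ', Matrix.mul_apply, Fin.sum_univ_five, ssP_pow_absorbing]
  simp [ssP]
  ring

lemma ssTail_succ_two (θ : ℝ) (n : ℕ) :
    ssTail θ (n + 1) 2 = (2 * (8 + θ) * ssTail θ n 0 + 4 * (26 + θ) * ssTail θ n 2) / 144 := by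
  simp only [ssTail]
  rw [pow_succ', Matrix.mul_apply, Fin.sum_univ_five, ssP_pow_absorbing]
  simp [ssP]
  ring

lemma ssTail_succ_three (θ : ℝ) (n : ℕ) :
    ssTail θ (n + 1) 3 = ((20 + 7 * θ) * ssTail θ n 0 + (100 - θ) * ssTail θ n 3) / 144 := by
  simp only [ssTail]
  rw [pow_succ', Matrix.mul_apply, Fin.sum_univ_five, ssP_pow_absorbing]
  simp [ssP]
  ring

/-- State `p4-10` has the smallest tail, and the tail from `p6-8` is at most seven times the tail
from `co`. -/
lemma ssTail_order {θ : ℝ} (h0 : 0 ≤ θ) (h1 : θ ≤ 1) (n : ℕ) :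
    0 ≤ ssTail θ n 1 ∧ ssTail θ n 1 ≤ ssTail θ n 0 ∧ ssTail θ n 1 ≤ ssTail θ n 2 ∧
      ssTail θ n 1 ≤ ssTail θ n 3 ∧ ssTail θ n 3 ≤ 7 * ssTail θ n 0 := by
  induction n with
  | zero =>
    simp only [ssTail_zero _ (show (0 : Fin 5) ≠ 4 by decide),
      ssTail_zero _ (show (1 : Fin 5) ≠ 4 by decide),
      ssTail_zero _ (show (2 : Fin 5) ≠ 4 by decide),
      ssTail_zero _ (show (3 : Fin 5) ≠ 4 by decide)]
    norm_num
  | succ n ih =>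
    rw [ssTail_succ_zero, ssTail_succ_one, ssTail_succ_two, ssTail_succ_three]
    generalize ssTail θ n 0 = c at *
    generalize ssTail θ n 1 = a at *
    generalize ssTail θ n 2 = b at *
    generalize ssTail θ n 3 = d at *
    obtain ⟨ha, hu, he, hf, -⟩ := ih
    obtain ⟨u, rfl⟩ : ∃ u, c = a + u := ⟨c - a, by ring⟩
    obtain ⟨e, rfl⟩ : ∃ e, b = a + e := ⟨b - a, by ring⟩
    obtain ⟨f, rfl⟩ : ∃ f, d = a + f := ⟨d - a, by ring⟩
    replace hu : 0 ≤ u := by linarith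
    replace he : 0 ≤ e := by linarith
    replace hf : 0 ≤ f := by linarith
    have h1' : 0 ≤ 1 - θ := by linarith
    have p1 := mul_nonneg h0 ha
    have p2 := mul_nonneg h0 hu
    have p3 := mul_nonneg h0 he
    have p4 := mul_nonneg h0 hf
    have q1 := mul_nonneg h1' ha
    have q2 := mul_nonneg h1' hu
    have q3 := mul_nonneg h1' he
    have q4 := mul_nonneg h1' hf
    refine ⟨?_, ?_, ?_, ?_, ?_⟩ <;> linarith

/-- The tails from the non-absorbing states are nondecreasing in `θ`. The induction carries the
claim for `co` one step ahead: the direct effect of `θ` on the first row may be negative, and is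
compensated by the gain of the point states at the preceding step. -/
lemma ssTail_mono {θ η : ℝ} (h0 : 0 ≤ θ) (h : θ ≤ η) (h1 : η ≤ 1) (n : ℕ) :
    ssTail θ n 0 ≤ ssTail η n 0 ∧ ssTail θ n 1 ≤ ssTail η n 1 ∧
      ssTail θ n 2 ≤ ssTail η n 2 ∧ ssTail θ n 3 ≤ ssTail η n 3 ∧
      ssTail θ (n + 1) 0 ≤ ssTail η (n + 1) 0 := by
  induction n with
  | zero =>
    rw [ssTail_succ_zero, ssTail_succ_zero]
    simp only [ssTail_zero _ (show (0 : Fin 5) ≠ 4 by decide),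
      ssTail_zero _ (show (1 : Fin 5) ≠ 4 by decide),
      ssTail_zero _ (show (2 : Fin 5) ≠ 4 by decide),
      ssTail_zero _ (show (3 : Fin 5) ≠ 4 by decide)]
    refine ⟨le_rfl, le_rfl, le_rfl, le_rfl, ?_⟩
    linarith
  | succ n ih =>
    obtain ⟨i0, i1, i2, i3, i0'⟩ := ih
    obtain ⟨ha, hu, he, hf, hd⟩ := ssTail_order h0 (h.trans h1) n
    have hh : 0 ≤ η - θ := by linarith
    have hη : 0 ≤ η := h0.trans h
    have g1 : (η - θ) * (6 * ssTail θ n 0) / 144 ≤ ssTail η (n + 1) 1 - ssTail θ (n + 1) 1 := by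
      rw [ssTail_succ_one, ssTail_succ_one]
      linarith [mul_nonneg hη (sub_nonneg.2 i0)]
    have g2 : (η - θ) * (2 * ssTail θ n 0 + 4 * ssTail θ n 2) / 144 ≤
        ssTail η (n + 1) 2 - ssTail θ (n + 1) 2 := by
      rw [ssTail_succ_two, ssTail_succ_two]
      linarith [mul_nonneg hη (sub_nonneg.2 i0), mul_nonneg hη (sub_nonneg.2 i2)]
    have g3 : (η - θ) * (7 * ssTail θ n 0 - ssTail θ n 3) / 144 ≤
        ssTail η (n + 1) 3 - ssTail θ (n + 1) 3 := by
      rw [ssTail_succ_three, ssTail_succ_three]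
      linarith [mul_nonneg hη (sub_nonneg.2 i0),
        mul_nonneg (sub_nonneg.2 h1) (sub_nonneg.2 i3)]
    have k1 : 0 ≤ ssTail η (n + 1) 1 - ssTail θ (n + 1) 1 :=
      le_trans (div_nonneg (mul_nonneg hh (by linarith)) (by norm_num)) g1
    have k2 : 0 ≤ ssTail η (n + 1) 2 - ssTail θ (n + 1) 2 :=
      le_trans (div_nonneg (mul_nonneg hh (by linarith)) (by norm_num)) g2
    have k3 : 0 ≤ ssTail η (n + 1) 3 - ssTail θ (n + 1) 3 :=
      le_trans (div_nonneg (mul_nonneg hh (by linarith)) (by norm_num)) g3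
    refine ⟨i0', sub_nonneg.1 k1, sub_nonneg.1 k2, sub_nonneg.1 k3, ?_⟩
    have key : 0 ≤ (18 * (6 * ssTail θ n 0) + 32 * (2 * ssTail θ n 0 + 4 * ssTail θ n 2) +
        40 * (7 * ssTail θ n 0 - ssTail θ n 3)) / 144 + (-12 * ssTail θ (n + 1) 0 -
        6 * ssTail θ (n + 1) 1 + 4 * ssTail θ (n + 1) 2 + 14 * ssTail θ (n + 1) 3) := by
      rw [ssTail_succ_zero, ssTail_succ_one, ssTail_succ_two, ssTail_succ_three]
      have hθ1 : 0 ≤ 1 - θ := by linarith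
      linarith [mul_nonneg h0 ha, mul_nonneg h0 (sub_nonneg.2 hu),
        mul_nonneg h0 (sub_nonneg.2 he), mul_nonneg h0 (sub_nonneg.2 hf),
        mul_nonneg hθ1 ha, mul_nonneg hθ1 (sub_nonneg.2 hu),
        mul_nonneg hθ1 (sub_nonneg.2 he), mul_nonneg hθ1 (sub_nonneg.2 hf)]
    rw [ssTail_succ_zero η (n + 1), ssTail_succ_zero θ (n + 1)]
    linarith [mul_nonneg hh key, mul_nonneg (sub_nonneg.2 h1) (sub_nonneg.2 i0'),
      mul_nonneg (sub_nonneg.2 h1) k1, mul_nonneg hη k2, mul_nonneg hη k3]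

/-- Under the Smith–Scott model, for every `m ≥ 1` the absorption probability
`(P_θ^m)_{co,7o}` is nonincreasing in `θ` on `[0,1]`; equivalently, for every `x ≥ 2`
the tail probability `P_θ(L ≥ x) = 1 − (P_θ^{x−1})_{co,7o}` is nondecreasing in `θ`
on `[0,1]`. -/
theorem smith_scott_tail_monotone :
    (∀ m : ℕ, 1 ≤ m → AntitoneOn (fun θ : ℝ => (ssP θ ^ m) 0 4) (Set.Icc 0 1)) ∧
    (∀ x : ℕ, 2 ≤ x →
      MonotoneOn (fun θ : ℝ => 1 - (ssP θ ^ (x - 1)) 0 4) (Set.Icc 0 1)) := by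
  have mono (m : ℕ) : MonotoneOn (fun θ : ℝ => 1 - (ssP θ ^ m) 0 4) (Set.Icc 0 1) :=
    fun _ hθ _ hη h => (ssTail_mono hθ.1 h hη.2 m).1
  exact ⟨fun m _ _ hθ _ hη h => (sub_le_sub_iff_left 1).1 (mono m hθ hη h),
    fun x _ => mono (x - 1)⟩
end

section
/- Under the Wong–Shackleford model, for every integer m ≥ 1, the function θ ↦ (P_θ^m)_{co,7o} is nonincreasing on [0,1]; equivalently, for every integer x ≥ 2, the tail probability P_θ(L ≥ x) = 1 − (P_θ^{x−1})_{co,7o} of the hand length L is nondecreasing in θ on [0,1]. -/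
/-- The probability that the chain started at state `i` has not reached `7o` after `n` steps. -/
noncomputable def wsSurvival (θ : ℝ) (n : ℕ) (i : Fin 5) : ℝ := 1 - (wsP θ ^ n) i 4

lemma wsSurvival_zero_of_ne (θ : ℝ) {i : Fin 5} (hi : i ≠ 4) : wsSurvival θ 0 i = 1 := by
  simp [wsSurvival, Matrix.one_apply_ne hi]

lemma wsP_row_sum (θ : ℝ) (i : Fin 5) : ∑ j, wsP θ i j = 1 := by
  fin_cases i <;> simp [wsP, Fin.sum_univ_five] <;> ring

lemma wsSurvival_succ (θ : ℝ) (n : ℕ) (i : Fin 5) :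
    wsSurvival θ (n + 1) i = ∑ j, wsP θ i j * wsSurvival θ n j := by
  simp only [wsSurvival, pow_succ', Matrix.mul_apply, mul_sub, mul_one, Finset.sum_sub_distrib,
    wsP_row_sum]

lemma wsSurvival_absorbed (θ : ℝ) (n : ℕ) : wsSurvival θ n 4 = 0 := by
  induction n with
  | zero => simp [wsSurvival]
  | succ n ih =>
    rw [wsSurvival_succ, Fin.sum_univ_five, ih]
    simp [wsP]

lemma wsSurvival_succ_co (θ : ℝ) (n : ℕ) :
    36 * wsSurvival θ (n + 1) 0 = 2 * (6 + θ) * wsSurvival θ n 0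
      + 2 * (3 - θ) * wsSurvival θ n 1 + 8 * wsSurvival θ n 2 + 10 * wsSurvival θ n 3 := by
  rw [wsSurvival_succ, Fin.sum_univ_five]
  simp [wsP]
  ring

lemma wsSurvival_succ_p4 (θ : ℝ) (n : ℕ) :
    36 * wsSurvival θ (n + 1) 1 = (3 + θ) * wsSurvival θ n 0
      + 3 * (9 + θ) * wsSurvival θ n 1 := by
  rw [wsSurvival_succ, Fin.sum_univ_five, wsSurvival_absorbed]
  simp [wsP]
  ring

lemma wsSurvival_succ_p5 (θ : ℝ) (n : ℕ) :
    36 * wsSurvival θ (n + 1) 2 = 4 * wsSurvival θ n 0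
      + 2 * (13 + 2 * θ) * wsSurvival θ n 2 := by
  rw [wsSurvival_succ, Fin.sum_univ_five, wsSurvival_absorbed]
  simp [wsP]
  ring

lemma wsSurvival_succ_p6 (θ : ℝ) (n : ℕ) :
    36 * wsSurvival θ (n + 1) 3 = (5 + θ) * wsSurvival θ n 0
      + (25 + 3 * θ) * wsSurvival θ n 3 := by
  rw [wsSurvival_succ, Fin.sum_univ_five, wsSurvival_absorbed]
  simp [wsP]
  ring

lemma wsP_nonneg {θ : ℝ} (hθ : θ ∈ Set.Icc (0 : ℝ) 1) (i j : Fin 5) : 0 ≤ wsP θ i j := by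
  obtain ⟨h0, h1⟩ := hθ
  fin_cases i <;> fin_cases j <;> simp [wsP] <;> linarith

lemma wsSurvival_nonneg {θ : ℝ} (hθ : θ ∈ Set.Icc (0 : ℝ) 1) (n : ℕ) (i : Fin 5) :
    0 ≤ wsSurvival θ n i := by
  induction n generalizing i with
  | zero =>
    by_cases hi : i = 4
    · rw [hi, wsSurvival_absorbed]
    · simp [wsSurvival_zero_of_ne θ hi]
  | succ n ih =>
    rw [wsSurvival_succ]
    exact Finset.sum_nonneg fun j _ => mul_nonneg (wsP_nonneg hθ i j) (ih j)

/-- The smallest row sum over the transient states bounds the one-step decay of survival. -/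
lemma wsSurvival_succ_ge {θ : ℝ} (hθ : θ ∈ Set.Icc (0 : ℝ) 1) (n : ℕ) (i : Fin 5) :
    (30 + 4 * θ) / 36 * wsSurvival θ n i ≤ wsSurvival θ (n + 1) i := by
  induction n generalizing i with
  | zero =>
    obtain ⟨h0, h1⟩ := hθ
    have hco := wsSurvival_succ_co θ 0
    have hp4 := wsSurvival_succ_p4 θ 0
    have hp5 := wsSurvival_succ_p5 θ 0
    have hp6 := wsSurvival_succ_p6 θ 0
    have h4 := wsSurvival_absorbed θ
    have hs (j : Fin 5) (hj : j ≠ 4) := wsSurvival_zero_of_ne θ hj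
    rw [hs 0 (by decide)] at hco hp4 hp5 hp6
    rw [hs 1 (by decide)] at hco hp4
    rw [hs 2 (by decide)] at hco hp5
    rw [hs 3 (by decide)] at hco hp6
    fin_cases i <;> simp [hs, h4] <;> linarith
  | succ n ih =>
    rw [wsSurvival_succ θ n, wsSurvival_succ θ (n + 1), Finset.mul_sum]
    refine Finset.sum_le_sum fun j _ => ?_
    rw [mul_left_comm]
    exact mul_le_mul_of_nonneg_left (ih j) (wsP_nonneg hθ i j)

lemma wsSurvival_p4_le_co {θ : ℝ} (hθ : θ ∈ Set.Icc (0 : ℝ) 1) (n : ℕ) :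
    wsSurvival θ n 1 ≤ wsSurvival θ n 0 := by
  induction n with
  | zero => rw [wsSurvival_zero_of_ne θ (by decide), wsSurvival_zero_of_ne θ (by decide)]
  | succ n ih =>
    have hco := wsSurvival_succ_ge hθ n 0
    have hp4 := wsSurvival_succ_p4 θ n
    have := mul_le_mul_of_nonneg_left ih (show 0 ≤ 3 * (9 + θ) by linarith [hθ.1])
    linarith

lemma wsP_sum_mul_wsSurvival_le {θ θ' : ℝ} (hθ : θ ∈ Set.Icc (0 : ℝ) 1) (h : θ ≤ θ')
    (n : ℕ) (i : Fin 5) :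
    ∑ j, wsP θ i j * wsSurvival θ n j ≤ ∑ j, wsP θ' i j * wsSurvival θ n j := by
  have hd : 0 ≤ θ' - θ := sub_nonneg.2 h
  have hs (j : Fin 5) := mul_nonneg hd (wsSurvival_nonneg hθ n j)
  have hp4 := mul_le_mul_of_nonneg_left (wsSurvival_p4_le_co hθ n) hd
  have h0 := hs 0
  have h1 := hs 1
  have h2 := hs 2
  have h3 := hs 3
  simp only [Fin.sum_univ_five, wsSurvival_absorbed]
  fin_cases i <;> simp [wsP] <;> linarith

lemma wsSurvival_monotoneOn (n : ℕ) (i : Fin 5) :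
    MonotoneOn (fun θ => wsSurvival θ n i) (Set.Icc 0 1) := by
  intro θ hθ θ' hθ' h
  induction n generalizing i with
  | zero => simp [wsSurvival]
  | succ n ih =>
    simp only [wsSurvival_succ] at ih ⊢
    exact (wsP_sum_mul_wsSurvival_le hθ h n i).trans <|
      Finset.sum_le_sum fun j _ => mul_le_mul_of_nonneg_left (ih j) (wsP_nonneg hθ' i j)

/-- Under the Wong–Shackleford model, for every `m ≥ 1` the absorption probability
`(P_θ^m)_{co,7o}` is nonincreasing in `θ` on `[0,1]`; equivalently, for every `x ≥ 2`
the tail probability `P_θ(L ≥ x) = 1 − (P_θ^{x−1})_{co,7o}` is nondecreasing in `θ`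
on `[0,1]`. -/
theorem wong_shackleford_tail_monotone :
    (∀ m : ℕ, 1 ≤ m → AntitoneOn (fun θ : ℝ => (wsP θ ^ m) 0 4) (Set.Icc 0 1)) ∧
    (∀ x : ℕ, 2 ≤ x →
      MonotoneOn (fun θ : ℝ => 1 - (wsP θ ^ (x - 1)) 0 4) (Set.Icc 0 1)) := by
  refine ⟨fun m _ θ hθ θ' hθ' h => ?_, fun x _ => wsSurvival_monotoneOn (x - 1) 0⟩
  exact (sub_le_sub_iff_left 1).1 (wsSurvival_monotoneOn m 0 hθ hθ' h)
end
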